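/- arXiv:2310.02788 — 2 statements merged into one kernel-verified Lean document; each statement's English description precedes it below -/
import Mathlib

section
/- Let K be the function field of a smooth projective curve over ℂ((t)), let L/K be a finite Galois extension with Galois group G, and let v be a place of K that is unramified in L/K (i.e. the inertia subgroup of every extension of v to L is trivial). Fix an extension B_v of v to L. Then the set of places w of K for which there exists an extension B_w of w to L whose decomposition group is conjugate in G to the decomposition group of B_v is infinite. -/
open scoped Pointwise

section

open Polynomial

/-- Evaluation of a bivariate polynomial at a point, along a homomorphism on coefficients. -/
noncomputable def bivEval {k A : Type*} [CommRing k] [CommRing A] (i : k →+* A) (x y : A) :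
    k[X][X] →+* A :=
  eval₂RingHom (eval₂RingHom i x) y

section bivEval

variable {k A B : Type*} [CommRing k] [CommRing A] [CommRing B]

@[simp] lemma bivEval_C (i : k →+* A) (x y : A) (p : k[X]) :
    bivEval i x y (C p) = p.eval₂ i x := by
  simp [bivEval]

@[simp] lemma bivEval_X (i : k →+* A) (x y : A) : bivEval i x y X = y := by
  simp [bivEval]

@[simp] lemma bivEval_map_C (i : k →+* A) (x y : A) (p : k[X]) :
    bivEval i x y (p.map C) = p.eval₂ i y := by
  simp only [bivEval, coe_eval₂RingHom, eval₂_map]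
  congr 1
  ext a
  simp

lemma map_bivEval (g : A →+* B) (i : k →+* A) (x y : A) (p : k[X][X]) :
    g (bivEval i x y p) = bivEval (g.comp i) (g x) (g y) p := by
  have : g.comp (bivEval i x y) = bivEval (g.comp i) (g x) (g y) := by
    refine Polynomial.ringHom_ext' (Polynomial.ringHom_ext' ?_ ?_) ?_
    · ext a; simp
    · simp
    · simp
  exact RingHom.congr_fun this p

lemma C_X_sub_C_dvd_sub_map (c : k) (p : k[X][X]) :
    C (X - C c) ∣ p - (p.map (evalRingHom c)).map C := by
  rw [C_dvd_iff_dvd_coeff]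
  intro n
  simpa using X_sub_C_dvd_sub_C_eval

lemma eval₂_map_evalRingHom (i : k →+* A) (y : A) (c : k) (p : k[X][X]) :
    (p.map (evalRingHom c)).eval₂ i y = bivEval i (i c) y p := by
  rw [bivEval, coe_eval₂RingHom, eval₂_map]
  congr 1
  refine Polynomial.ringHom_ext' ?_ ?_
  · ext a; simp
  · simp

end bivEval

section Valuation

variable {k L : Type*} [Field k] [Field L] [Algebra k L] {W : ValuationSubring L}

lemma valuation_algebraMap_le_one (hk : ∀ c : k, algebraMap k L c ∈ W) (c : k) :
    W.valuation (algebraMap k L c) ≤ 1 :=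
  (W.valuation_le_one_iff _).2 (hk c)

lemma valuation_algebraMap_eq_one (hk : ∀ c : k, algebraMap k L c ∈ W) {c : k} (hc : c ≠ 0) :
    W.valuation (algebraMap k L c) = 1 := by
  refine le_antisymm (valuation_algebraMap_le_one hk c) ?_
  have h := valuation_algebraMap_le_one hk c⁻¹
  rw [map_inv₀, map_inv₀] at h
  have h0 : 0 < W.valuation (algebraMap k L c) := by
    rw [zero_lt_iff, Valuation.ne_zero_iff]
    simpa using hc
  exact (inv_le_one₀ h0).1 h

lemma aeval_mem_valuationSubring (hk : ∀ c : k, algebraMap k L c ∈ W) {a : L} (ha : a ∈ W)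
    (q : k[X]) : aeval a q ∈ W := by
  induction q using Polynomial.induction_on' with
  | add p q hp hq => simpa using W.add_mem _ _ hp hq
  | monomial n c => simpa [aeval_monomial] using W.mul_mem _ _ (hk c) (pow_mem ha n)

lemma valuation_aeval_eq_one (hk : ∀ c : k, algebraMap k L c ∈ W) {a : L}
    (ha : W.valuation a < 1) {q : k[X]} (hq : q.coeff 0 ≠ 0) :
    W.valuation (aeval a q) = 1 := by
  have h := congrArg (aeval a) (divX_mul_X_add q)
  rw [map_add, map_mul, aeval_X, aeval_C] at h
  have h1 : W.valuation (aeval a q.divX * a) < 1 := by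
    rw [map_mul]
    exact (mul_le_of_le_one_left' ((W.valuation_le_one_iff _).2 (aeval_mem_valuationSubring hk
      ((W.valuation_le_one_iff _).1 ha.le) _))).trans_lt ha
  rw [← h, Valuation.map_add_eq_of_lt_right _ (by rwa [valuation_algebraMap_eq_one hk hq]),
    valuation_algebraMap_eq_one hk hq]

lemma exists_valuation_aeval_eq_pow (hk : ∀ c : k, algebraMap k L c ∈ W) {a : L}
    (ha : W.valuation a < 1) {q : k[X]} (hq : q ≠ 0) :
    ∃ n : ℕ, W.valuation (aeval a q) = W.valuation a ^ n := by
  obtain ⟨p, hp, hp0⟩ := exists_eq_pow_rootMultiplicity_mul_and_not_dvd q hq 0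
  rw [C_0, sub_zero] at hp hp0
  refine ⟨rootMultiplicity 0 q, ?_⟩
  rw [X_dvd_iff] at hp0
  conv_lhs => rw [hp]
  simp [valuation_aeval_eq_one hk ha hp0]

lemma transcendental_of_valuation_lt_one (hk : ∀ c : k, algebraMap k L c ∈ W) {a : L}
    (ha : W.valuation a < 1) (ha0 : a ≠ 0) : Transcendental k a := by
  rw [transcendental_iff]
  intro p hp
  by_contra hp0
  obtain ⟨n, hn⟩ := exists_valuation_aeval_eq_pow hk ha hp0
  rw [hp, map_zero] at hn
  exact pow_ne_zero n ((Valuation.ne_zero_iff _).2 ha0) hn.symm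

/-- A valuation which is nontrivial on `k(a)` with `L` algebraic over `k(a)` has no nonzero element
which is divisible by all powers of `a`. -/
lemma exists_pow_le_valuation (hk : ∀ c : k, algebraMap k L c ∈ W) {a z : L}
    (ha : W.valuation a < 1) (hz : z ≠ 0) 
    (halg : ∃ p : k[X][X], p ≠ 0 ∧ bivEval (algebraMap k L) a z p = 0) :
    ∃ n : ℕ, W.valuation a ^ n ≤ W.valuation z := by
  by_contra! hcon
  obtain ⟨p, hp, hpz⟩ := halg
  have hz1 : W.valuation z < 1 := by simpa using hcon 0
  wlog hp0 : p.coeff 0 ≠ 0 generalizing p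
  · obtain ⟨q, hq, hq0⟩ := exists_eq_pow_rootMultiplicity_mul_and_not_dvd p hp 0
    rw [C_0, sub_zero] at hq hq0
    rw [X_dvd_iff] at hq0
    refine this q (by rintro rfl; simp at hq0) ?_ hq0
    rw [hq, map_mul, map_pow, bivEval_X] at hpz
    exact (mul_eq_zero.1 hpz).resolve_left (pow_ne_zero _ hz)
  obtain ⟨n, hn⟩ := exists_valuation_aeval_eq_pow hk ha hp0
  have h := congrArg (bivEval (algebraMap k L) a z) (divX_mul_X_add p)
  rw [map_add, map_mul, bivEval_X, bivEval_C, ← aeval_def, hpz] at h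
  have hmem : bivEval (algebraMap k L) a z p.divX ∈ W := by
    have ha' : a ∈ W := (W.valuation_le_one_iff _).1 ha.le
    have hz' : z ∈ W := (W.valuation_le_one_iff _).1 hz1.le
    generalize p.divX = q
    induction q using Polynomial.induction_on' with
    | add p q hp hq => simpa using W.add_mem _ _ hp hq
    | monomial n c =>
      rw [← C_mul_X_pow_eq_monomial, map_mul, map_pow, bivEval_X, bivEval_C]
      exact W.mul_mem _ _ (aeval_mem_valuationSubring hk ha' c) (pow_mem hz' n)
  have h2 : aeval a (p.coeff 0) = -(bivEval (algebraMap k L) a z p.divX * z) :=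
    eq_neg_of_add_eq_zero_right h
  have h3 := hcon n
  rw [← hn, h2, Valuation.map_neg, map_mul] at h3
  exact absurd h3 (not_lt.2 (mul_le_of_le_one_left' ((W.valuation_le_one_iff _).2 hmem)))

end Valuation

section Coordinates

variable {k L : Type*} [Field k] [Field L] [Algebra k L] {W : ValuationSubring L}

lemma bivEval_codRestrict (hk : ∀ c : k, algebraMap k L c ∈ W) {x y : L} (hx : x ∈ W) (hy : y ∈ W)
    (p : k[X][X]) :
    (bivEval ((algebraMap k L).codRestrict W hk) ⟨x, hx⟩ ⟨y, hy⟩ p : L) =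
      bivEval (algebraMap k L) x y p :=
  map_bivEval W.subtype _ _ _ p

lemma bivEval_mem (hk : ∀ c : k, algebraMap k L c ∈ W) {x y : L} (hx : x ∈ W) (hy : y ∈ W)
    (p : k[X][X]) : bivEval (algebraMap k L) x y p ∈ W := by
  rw [← bivEval_codRestrict hk hx hy]
  exact Subtype.prop _

lemma residue_eq_zero_iff_valuation (x : W) :
    IsLocalRing.residue W x = 0 ↔ W.valuation (x : L) < 1 := by
  rw [IsLocalRing.residue_eq_zero_iff, W.valuation_lt_one_iff]

variable {f : k[X][X]} {π θ : L} {c : k}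

/-- At a smooth point of the curve `f(π, θ) = 0` every function vanishing at the point is locally a
multiple of the coordinate `π - c`. -/
lemma exists_mul_eq_mul_of_valuation_lt_one (hf : bivEval (algebraMap k L) π θ f = 0)
    (hk : ∀ c : k, algebraMap k L c ∈ W) (hπ : W.valuation (π - algebraMap k L c) < 1)
    (hθ : θ ∈ W) (hf' : W.valuation (bivEval (algebraMap k L) π θ (derivative f)) = 1)
    {p : k[X][X]} (hp : W.valuation (bivEval (algebraMap k L) π θ p) < 1) :
    ∃ p' q : k[X][X], W.valuation (bivEval (algebraMap k L) π θ q) = 1 ∧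
      bivEval (algebraMap k L) π θ p * bivEval (algebraMap k L) π θ q =
        (π - algebraMap k L c) * bivEval (algebraMap k L) π θ p' := by
  have hπW : π ∈ W := by
    simpa using W.add_mem _ _ ((W.valuation_le_one_iff _).1 hπ.le) (hk c)
  set i : k →+* IsLocalRing.ResidueField W :=
    (IsLocalRing.residue W).comp ((algebraMap k L).codRestrict W hk) with hi
  let _ : Algebra k (IsLocalRing.ResidueField W) := i.toAlgebra
  set b := IsLocalRing.residue W ⟨θ, hθ⟩ with hb
  have hres : ∀ q : k[X][X], W.valuation (bivEval (algebraMap k L) π θ q) < 1 ↔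
      aeval b (q.map (evalRingHom c)) = 0 := by
    intro q
    have hc : IsLocalRing.residue W ⟨π, hπW⟩ = i c := by
      rw [← sub_eq_zero, hi, RingHom.comp_apply, ← map_sub, residue_eq_zero_iff_valuation]
      exact hπ
    rw [← bivEval_codRestrict hk hπW hθ, ← residue_eq_zero_iff_valuation, map_bivEval, hc, ← hi,
      ← eval₂_map_evalRingHom]
    rfl
  have hfc : aeval b (f.map (evalRingHom c)) = 0 := (hres f).1 (by simp [hf])
  have hfc' : aeval b (derivative (f.map (evalRingHom c))) ≠ 0 := by
    rw [derivative_map, Ne, ← hres, hf']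
    exact lt_irrefl _
  obtain ⟨r, hr⟩ := minpoly.dvd k b hfc
  obtain ⟨s, hs⟩ := minpoly.dvd k b ((hres p).1 hp)
  have hrb : aeval b r ≠ 0 := by
    intro h
    apply hfc'
    rw [hr, derivative_mul]
    simp [h]
  have hrs : r * p.map (evalRingHom c) = s * f.map (evalRingHom c) := by rw [hr, hs]; ring
  obtain ⟨p₁, hp₁⟩ := C_X_sub_C_dvd_sub_map c p
  obtain ⟨f₁, hf₁⟩ := C_X_sub_C_dvd_sub_map c f
  refine ⟨p₁ * r.map C - s.map C * f₁, r.map C, ?_, ?_⟩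
  · refine le_antisymm ((W.valuation_le_one_iff _).2 (bivEval_mem hk hπW hθ _)) ?_
    rw [← not_lt, hres]
    have : (r.map C).map (evalRingHom c) = r := by
      rw [Polynomial.map_map]
      convert Polynomial.map_id
      ext a; simp
    rwa [this]
  · have h1 := congrArg (bivEval (algebraMap k L) π θ) hp₁
    have h2 := congrArg (bivEval (algebraMap k L) π θ) hf₁
    have h3 := congrArg (fun q => bivEval (algebraMap k L) π θ (q.map C)) hrs
    simp only [Polynomial.map_mul, map_mul, map_sub, bivEval_C, hf, eval₂_X,
      eval₂_C] at h1 h2 h3 ⊢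
    linear_combination bivEval (algebraMap k L) π θ (r.map C) * h1 -
      bivEval (algebraMap k L) π θ (s.map C) * h2 + h3

lemma exists_mul_eq_pow_mul (hf : bivEval (algebraMap k L) π θ f = 0)
    (hk : ∀ c : k, algebraMap k L c ∈ W) (hπ : W.valuation (π - algebraMap k L c) < 1)
    (hπ0 : π - algebraMap k L c ≠ 0)
    (hθ : θ ∈ W) (hf' : W.valuation (bivEval (algebraMap k L) π θ (derivative f)) = 1) (N : ℕ)
    {p : k[X][X]} (hp : W.valuation (π - algebraMap k L c) ^ N ≤
      W.valuation (bivEval (algebraMap k L) π θ p)) :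
    ∃ (n : ℕ) (p' q : k[X][X]), W.valuation (bivEval (algebraMap k L) π θ p') = 1 ∧
      W.valuation (bivEval (algebraMap k L) π θ q) = 1 ∧
      bivEval (algebraMap k L) π θ p * bivEval (algebraMap k L) π θ q =
        (π - algebraMap k L c) ^ n * bivEval (algebraMap k L) π θ p' := by
  have hπW : π ∈ W := by
    simpa using W.add_mem _ _ ((W.valuation_le_one_iff _).1 hπ.le) (hk c)
  induction N generalizing p with
  | zero =>
    exact ⟨0, p, 1, le_antisymm ((W.valuation_le_one_iff _).2 (bivEval_mem hk hπW hθ _))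
      (by simpa using hp), by simp, by simp⟩
  | succ N ih =>
    rcases ((W.valuation_le_one_iff _).2 (bivEval_mem hk hπW hθ p)).eq_or_lt with h1 | h1
    · exact ⟨0, p, 1, h1, by simp, by simp⟩
    obtain ⟨p₁, q₁, hq₁, h⟩ := exists_mul_eq_mul_of_valuation_lt_one hf hk hπ hθ hf' h1
    have hv : W.valuation (bivEval (algebraMap k L) π θ p) =
        W.valuation (π - algebraMap k L c) * W.valuation (bivEval (algebraMap k L) π θ p₁) := by
      have := congrArg W.valuation h
      rwa [map_mul, map_mul, hq₁, mul_one] at this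
    have hpos : 0 < W.valuation (π - algebraMap k L c) := by
      rwa [zero_lt_iff, Valuation.ne_zero_iff]
    rw [hv, pow_succ', mul_le_mul_iff_right₀ hpos] at hp
    obtain ⟨n, p', q, hp', hq, h'⟩ := ih hp
    refine ⟨n + 1, p', q₁ * q, hp', by simp [hq₁, hq], ?_⟩
    rw [map_mul, ← mul_assoc, h, mul_assoc, h']
    ring

/-- At a smooth point of the curve `f(π, θ) = 0`, the valuation ring is the local ring. -/
lemma exists_eq_div_of_mem (hf : bivEval (algebraMap k L) π θ f = 0)
    (hgen : ∀ x : L, ∃ p q : k[X][X], bivEval (algebraMap k L) π θ q ≠ 0 ∧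
      x = bivEval (algebraMap k L) π θ p / bivEval (algebraMap k L) π θ q)
    (hk : ∀ c : k, algebraMap k L c ∈ W) (hπ : W.valuation (π - algebraMap k L c) < 1)
    (hπ0 : π - algebraMap k L c ≠ 0)
    (hθ : θ ∈ W) (hf' : W.valuation (bivEval (algebraMap k L) π θ (derivative f)) = 1)
    (hdisc : ∀ z : L, z ≠ 0 → ∃ n : ℕ, W.valuation (π - algebraMap k L c) ^ n ≤ W.valuation z)
    {x : L} (hx : x ∈ W) :
    ∃ p q : k[X][X], W.valuation (bivEval (algebraMap k L) π θ q) = 1 ∧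
      x = bivEval (algebraMap k L) π θ p / bivEval (algebraMap k L) π θ q := by
  obtain ⟨p, q, hq, rfl⟩ := hgen x
  by_cases hp : bivEval (algebraMap k L) π θ p = 0
  · exact ⟨0, 1, by simp, by simp [hp]⟩
  obtain ⟨N, hN⟩ := hdisc _ hp
  obtain ⟨M, hM⟩ := hdisc _ hq
  obtain ⟨n, p₁, p₂, hp₁, hp₂, hpp⟩ := exists_mul_eq_pow_mul hf hk hπ hπ0 hθ hf' N hN
  obtain ⟨m, q₁, q₂, hq₁, hq₂, hqq⟩ := exists_mul_eq_pow_mul hf hk hπ hπ0 hθ hf' M hM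
  have hne : ∀ {r : k[X][X]}, W.valuation (bivEval (algebraMap k L) π θ r) = 1 →
      bivEval (algebraMap k L) π θ r ≠ 0 := fun h h0 => by simp [h0] at h
  have hpos : 0 < W.valuation (π - algebraMap k L c) := by
    rwa [zero_lt_iff, Valuation.ne_zero_iff]
  have hvp := congrArg W.valuation hpp
  have hvq := congrArg W.valuation hqq
  simp only [map_mul, map_pow, hp₁, hp₂, hq₁, hq₂, mul_one] at hvp hvq
  have hmn : m ≤ n := by
    rw [← W.valuation_le_one_iff, map_div₀, hvp, hvq, div_le_one₀ (pow_pos hpos _)] at hx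
    exact (pow_le_pow_iff_right_of_lt_one₀ hpos hπ).1 hx
  obtain ⟨d, rfl⟩ := Nat.exists_eq_add_of_le hmn
  refine ⟨(C (X - C c)) ^ d * p₁ * q₂, p₂ * q₁, by simp [hp₂, hq₁], ?_⟩
  rw [div_eq_div_iff hq (by simpa using ⟨hne hp₂, hne hq₁⟩)]
  have h2 := hne hp₂
  have h3 := hne hq₂
  have h4 : (π - algebraMap k L c) ^ m ≠ 0 := pow_ne_zero _ hπ0
  simp only [map_mul, map_pow, bivEval_C, eval₂_sub, eval₂_X, eval₂_C]
  linear_combination bivEval (algebraMap k L) π θ q₁ * hpp -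
    (π - algebraMap k L c) ^ d * bivEval (algebraMap k L) π θ p₁ * hqq

end Coordinates

/-- An `F`-valued place of `L` over `k`: a valuation ring of `L` containing `k` together with an
embedding over `k` of its residue field into `F`. -/
structure FieldPlace (k L F : Type*) [Field k] [Field L] [Field F] [Algebra k L] [Algebra k F] where
  /-- The valuation ring of the place. -/
  ring : ValuationSubring L
  algebraMap_mem : ∀ c : k, algebraMap k L c ∈ ring
  /-- The evaluation homomorphism of the place. -/
  toRingHom : ring →+* F
  map_algebraMap : ∀ c : k, toRingHom ⟨algebraMap k L c, algebraMap_mem c⟩ = algebraMap k F c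
  eq_zero_iff : ∀ x : ring, toRingHom x = 0 ↔ ring.valuation (x : L) < 1

namespace FieldPlace

variable {k L F : Type*} [Field k] [Field L] [Field F] [Algebra k L] [Algebra k F]

/-- The relation that a function is regular at a place and has the given value there. -/
def Val (P : FieldPlace k L F) (x : L) (y : F) : Prop :=
  ∃ hx : x ∈ P.ring, P.toRingHom ⟨x, hx⟩ = y

variable {P : FieldPlace k L F} {x x' : L} {y y' : F}

lemma Val.mem (h : P.Val x y) : x ∈ P.ring := h.1

lemma Val.unique (h : P.Val x y) (h' : P.Val x y') : y = y' := by
  obtain ⟨_, rfl⟩ := h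
  obtain ⟨_, rfl⟩ := h'
  rfl

lemma exists_val (hx : x ∈ P.ring) : ∃ y, P.Val x y := ⟨_, hx, rfl⟩

lemma Val.eq_zero_iff (h : P.Val x y) : y = 0 ↔ P.ring.valuation x < 1 := by
  obtain ⟨hx, rfl⟩ := h
  exact P.eq_zero_iff _

lemma val_zero_of_lt (h : P.ring.valuation x < 1) : P.Val x 0 := by
  obtain ⟨y, hy⟩ := exists_val ((P.ring.valuation_le_one_iff x).1 h.le)
  rwa [hy.eq_zero_iff.2 h] at hy

lemma Val.valuation_eq_one (h : P.Val x y) (hy : y ≠ 0) : P.ring.valuation x = 1 :=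
  le_antisymm ((P.ring.valuation_le_one_iff x).2 h.mem)
    (not_lt.1 fun hlt => hy (h.eq_zero_iff.2 hlt))

lemma Val.ne_zero_of_valuation (h : P.Val x y) (hx : P.ring.valuation x = 1) : y ≠ 0 := by
  rw [Ne, h.eq_zero_iff, hx]
  exact lt_irrefl _

lemma Val.ne_zero (h : P.Val x y) (hy : y ≠ 0) : x ≠ 0 := by
  rintro rfl
  exact hy (h.eq_zero_iff.2 (by simp))

lemma val_algebraMap (P : FieldPlace k L F) (c : k) :
    P.Val (algebraMap k L c) (algebraMap k F c) := ⟨_, P.map_algebraMap c⟩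

lemma Val.mul (h : P.Val x y) (h' : P.Val x' y') : P.Val (x * x') (y * y') := by
  obtain ⟨hx, rfl⟩ := h
  obtain ⟨hx', rfl⟩ := h'
  exact ⟨P.ring.mul_mem _ _ hx hx', map_mul P.toRingHom ⟨x, hx⟩ ⟨x', hx'⟩⟩

lemma Val.sub (h : P.Val x y) (h' : P.Val x' y') : P.Val (x - x') (y - y') := by
  obtain ⟨hx, rfl⟩ := h
  obtain ⟨hx', rfl⟩ := h'
  exact ⟨sub_mem hx hx', map_sub P.toRingHom ⟨x, hx⟩ ⟨x', hx'⟩⟩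

lemma Val.pow (h : P.Val x y) (n : ℕ) : P.Val (x ^ n) (y ^ n) := by
  obtain ⟨hx, rfl⟩ := h
  exact ⟨pow_mem hx n, map_pow P.toRingHom ⟨x, hx⟩ n⟩

lemma Val.inv (h : P.Val x y) (hy : y ≠ 0) : P.Val x⁻¹ y⁻¹ := by
  have hmem : x⁻¹ ∈ P.ring := by
    rw [← P.ring.valuation_le_one_iff, map_inv₀, h.valuation_eq_one hy, inv_one]
  obtain ⟨z, hz⟩ := exists_val hmem
  have h1 := h.mul hz
  rw [mul_inv_cancel₀ (h.ne_zero hy)] at h1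
  have h2 := P.val_algebraMap 1
  rw [map_one, map_one] at h2
  rwa [eq_inv_of_mul_eq_one_right (h1.unique h2)] at hz

lemma Val.div (h : P.Val x y) (h' : P.Val x' y') (hy : y' ≠ 0) : P.Val (x / x') (y / y') := by
  rw [div_eq_mul_inv, div_eq_mul_inv]
  exact h.mul (h'.inv hy)

lemma Val.bivEval (h : P.Val x y) (h' : P.Val x' y') (p : k[X][X]) :
    P.Val (bivEval (algebraMap k L) x x' p) (bivEval (algebraMap k F) y y' p) := by
  obtain ⟨hx, rfl⟩ := h
  obtain ⟨hx', rfl⟩ := h'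
  refine ⟨bivEval_mem P.algebraMap_mem hx hx' p, ?_⟩
  have : (⟨_, bivEval_mem P.algebraMap_mem hx hx' p⟩ : P.ring) = _root_.bivEval
      ((algebraMap k L).codRestrict P.ring P.algebraMap_mem) ⟨x, hx⟩ ⟨x', hx'⟩ p :=
    Subtype.ext (bivEval_codRestrict P.algebraMap_mem hx hx' p).symm
  rw [this, map_bivEval]
  congr 2
  ext c
  exact P.map_algebraMap c

lemma Val.aeval (h : P.Val x y) (q : k[X]) : P.Val (aeval x q) (aeval y q) := by
  simpa [aeval_def] using h.bivEval h (C q)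

/-- The minimal polynomial of a value is determined by the polynomials in the function which
vanish. -/
lemma Val.minpoly_eq {P P' : FieldPlace k L F} (h : P.Val x y) (h' : P'.Val x' y')
    (hy : IsIntegral k y)
    (H : ∀ q : k[X], P.ring.valuation (Polynomial.aeval x q) < 1 →
      P'.ring.valuation (Polynomial.aeval x' q) < 1) :
    minpoly k y = minpoly k y' := by
  refine minpoly.eq_of_irreducible_of_monic (minpoly.irreducible hy) ?_ (minpoly.monic hy)
  rw [(h'.aeval _).eq_zero_iff]
  exact H _ ((h.aeval _).eq_zero_iff.1 (minpoly.aeval k y))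

variable {f : k[X][X]} {π θ : L} {c : k} {β : F}

/-- At a smooth point of the curve `f(π, θ) = 0`, every element of the valuation ring is a quotient
of polynomials in the coordinates with nonvanishing denominator. -/
lemma exists_eq_div_of_mem (P : FieldPlace k L F)
    (halg : ∀ a z : L, Transcendental k a →
      ∃ p : k[X][X], p ≠ 0 ∧ _root_.bivEval (algebraMap k L) a z p = 0)
    (hπt : Transcendental k π)
    (hf : _root_.bivEval (algebraMap k L) π θ f = 0)
    (hgen : ∀ x : L, ∃ p q : k[X][X], _root_.bivEval (algebraMap k L) π θ q ≠ 0 ∧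
      x = _root_.bivEval (algebraMap k L) π θ p / _root_.bivEval (algebraMap k L) π θ q)
    (hπ : P.Val π (algebraMap k F c)) (hθ : P.Val θ β)
    (hf' : _root_.bivEval (algebraMap k F) (algebraMap k F c) β (derivative f) ≠ 0)
    (hx : x ∈ P.ring) :
    ∃ p q : k[X][X], _root_.bivEval (algebraMap k F) (algebraMap k F c) β q ≠ 0 ∧
      x = _root_.bivEval (algebraMap k L) π θ p / _root_.bivEval (algebraMap k L) π θ q := by
  have hlt : P.ring.valuation (π - algebraMap k L c) < 1 := by
    rw [← (hπ.sub (P.val_algebraMap c)).eq_zero_iff, sub_self]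
  have hne : π - algebraMap k L c ≠ 0 := by
    intro h
    rw [sub_eq_zero] at h
    exact hπt (h ▸ isAlgebraic_algebraMap c)
  obtain ⟨p, q, hq, rfl⟩ := _root_.exists_eq_div_of_mem hf hgen P.algebraMap_mem hlt hne hθ.mem
    ((hπ.bivEval hθ _).valuation_eq_one hf')
    (fun z hz => exists_pow_le_valuation P.algebraMap_mem hlt hz
      (halg _ _ (transcendental_of_valuation_lt_one P.algebraMap_mem hlt hne))) hx
  exact ⟨p, q, (hπ.bivEval hθ q).ne_zero_of_valuation hq, rfl⟩

/-- A smooth point of the curve `f(π, θ) = 0` with coordinate `c` in `k` defines a place. -/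
lemma exists_of_smooth_point
    (halg : ∀ a z : L, Transcendental k a →
      ∃ p : k[X][X], p ≠ 0 ∧ _root_.bivEval (algebraMap k L) a z p = 0)
    (hπt : Transcendental k π)
    (hf : _root_.bivEval (algebraMap k L) π θ f = 0)
    (hker : ∀ p, _root_.bivEval (algebraMap k L) π θ p = 0 → f ∣ p)
    (hgen : ∀ x : L, ∃ p q : k[X][X], _root_.bivEval (algebraMap k L) π θ q ≠ 0 ∧
      x = _root_.bivEval (algebraMap k L) π θ p / _root_.bivEval (algebraMap k L) π θ q)
    (hβ : IsIntegral k β)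
    (hfβ : _root_.bivEval (algebraMap k F) (algebraMap k F c) β f = 0)
    (hf' : _root_.bivEval (algebraMap k F) (algebraMap k F c) β (derivative f) ≠ 0) :
    ∃ P : FieldPlace k L F, P.Val π (algebraMap k F c) ∧ P.Val θ β := by
  set h := _root_.bivEval (algebraMap k F) (algebraMap k F c) β with hh
  set e := _root_.bivEval (algebraMap k L) π θ with he
  have heh : ∀ {p}, e p = 0 → h p = 0 := fun {p} hp => by
    obtain ⟨r, rfl⟩ := hker p hp
    rw [map_mul, hfβ, zero_mul]
  let I : Ideal e.range := (RingHom.ker h).map e.rangeRestrict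
  have hI : I ≠ ⊤ := by
    rw [Ne, Ideal.eq_top_iff_one, Ideal.mem_map_iff_of_surjective _ e.rangeRestrict_surjective]
    rintro ⟨p, hp, hp1⟩
    have h1 : e (p - 1) = 0 := by
      rw [map_sub, map_one, sub_eq_zero]
      exact congrArg Subtype.val hp1
    have h2 := heh h1
    rw [map_sub, (RingHom.mem_ker).1 hp] at h2
    simp at h2
  obtain ⟨W, hAW, hIW⟩ := I.image_subset_nonunits_valuationSubring hI
  have hW : ∀ p, e p ∈ W := fun p => hAW ⟨p, rfl⟩
  have hlt : ∀ {p}, h p = 0 → W.valuation (e p) < 1 := fun {p} hp =>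
    W.mem_nonunits_iff.1 (hIW ⟨_, Ideal.mem_map_of_mem e.rangeRestrict (RingHom.mem_ker.2 hp), rfl⟩)
  have hsurj : ∀ p, h p ≠ 0 → ∃ q, h (p * q - 1) = 0 := by
    intro p hp
    have hmem : h p ∈ Algebra.adjoin k {β} := by
      rw [hh, ← eval₂_map_evalRingHom]
      exact aeval_mem_adjoin_singleton k β
    have hint : IsIntegral k (h p) :=
      IsIntegral.of_mem_of_fg (Algebra.adjoin k {β}) hβ.fg_adjoin_singleton (h p) hmem
    have hinv : (h p)⁻¹ ∈ Algebra.adjoin k {β} :=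
      Subalgebra.inv_mem_of_algebraic (A := Algebra.adjoin k {β})
      (x := ⟨h p, hmem⟩) hint.isAlgebraic
    rw [Algebra.adjoin_singleton_eq_range_aeval] at hinv
    obtain ⟨s, hs⟩ := hinv
    refine ⟨s.map C, ?_⟩
    have hs' : h (s.map C) = (h p)⁻¹ := by rw [hh, bivEval_map_C, ← aeval_def]; exact hs
    rw [map_sub, map_mul, hs', mul_inv_cancel₀ hp, map_one, sub_self]
  have hk : ∀ a : k, algebraMap k L a ∈ W := fun a => by simpa [he] using hW (C (C a))
  have hπW : π ∈ W := by simpa [he] using hW (C X)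
  have hθW : θ ∈ W := by simpa [he] using hW X
  have hiff : ∀ p, W.valuation (e p) < 1 ↔ h p = 0 := by
    refine fun p => ⟨fun hp => ?_, hlt⟩
    by_contra hp0
    obtain ⟨q, hq⟩ := hsurj p hp0
    have h1 := hlt hq
    have h2 : W.valuation (e (p * q)) < 1 := by
      rw [map_mul, map_mul]
      exact (mul_le_of_le_one_right' ((W.valuation_le_one_iff _).2 (hW q))).trans_lt hp
    have h3 := Valuation.map_sub W.valuation (e (p * q)) (e (p * q - 1))
    rw [← map_sub, sub_sub_cancel, map_one, map_one] at h3
    exact absurd (h3.trans_lt (max_lt h2 h1)) (lt_irrefl _)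
  have hmem1 : ∀ p, h p ≠ 0 → W.valuation (e p) = 1 := fun p hp =>
    le_antisymm ((W.valuation_le_one_iff _).2 (hW p)) (not_lt.1 fun hl => hp ((hiff p).1 hl))
  have hπlt : W.valuation (π - algebraMap k L c) < 1 := by
    have := hlt (p := C (X - C c)) (by rw [hh, bivEval_C, eval₂_sub, eval₂_X, eval₂_C, sub_self])
    rwa [he, bivEval_C, eval₂_sub, eval₂_X, eval₂_C] at this
  have hne : π - algebraMap k L c ≠ 0 := by
    intro h
    rw [sub_eq_zero] at h
    exact hπt (h ▸ isAlgebraic_algebraMap c)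
  let g : k[X][X] →+* IsLocalRing.ResidueField W := (IsLocalRing.residue W).comp
    (_root_.bivEval ((algebraMap k L).codRestrict W hk) ⟨π, hπW⟩ ⟨θ, hθW⟩)
  have hg0 : ∀ p, g p = 0 ↔ h p = 0 := by
    intro p
    rw [← hiff, RingHom.comp_apply, residue_eq_zero_iff_valuation, bivEval_codRestrict]
  have hgs : Function.Surjective g := by
    intro y
    obtain ⟨⟨x, hx⟩, rfl⟩ := IsLocalRing.residue_surjective y
    obtain ⟨p, q, hq, hxpq⟩ := _root_.exists_eq_div_of_mem hf hgen hk hπlt hne hθW (hmem1 _ hf')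
      (fun z hz => exists_pow_le_valuation hk hπlt hz
        (halg _ _ (transcendental_of_valuation_lt_one hk hπlt hne))) hx
    have hq0 : h q ≠ 0 := by rw [Ne, ← hiff, hq]; exact lt_irrefl _
    obtain ⟨r, hr⟩ := hsurj q hq0
    refine ⟨p * r, ?_⟩
    have h1 : g q * g r = 1 := by
      rw [← sub_eq_zero, ← map_mul, ← map_one g, ← map_sub, hg0, hr]
    have h2 : g p = IsLocalRing.residue W ⟨x, hx⟩ * g q := by
      simp only [g, RingHom.comp_apply, ← map_mul]
      congr 1
      apply Subtype.ext
      have : e q ≠ 0 := fun h0 => hq0 (heh h0)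
      have h3 : e p = x * e q := by
        conv_rhs => rw [hxpq]
        rw [div_mul_cancel₀ _ this]
      rw [bivEval_codRestrict, h3]
      change _ = x * _
      rw [bivEval_codRestrict]
    rw [map_mul, h2, mul_assoc, h1, mul_one]
  let ρ := RingHom.liftOfSurjective g hgs ⟨h, fun p hp => (hg0 p).1 hp⟩
  have hρ : ∀ p, ρ (g p) = h p := fun p =>
    RingHom.liftOfRightInverse_comp_apply g _ _ ⟨h, fun p hp => (hg0 p).1 hp⟩ p
  refine ⟨⟨W, hk, ρ.comp (IsLocalRing.residue W), fun a => ?_, fun x => ?_⟩, ⟨hπW, ?_⟩, ⟨hθW, ?_⟩⟩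
  · have := hρ (C (C a))
    simp only [g, hh, RingHom.comp_apply, bivEval_C, eval₂_C] at this
    exact this
  · rw [RingHom.comp_apply, map_eq_zero, residue_eq_zero_iff_valuation]
  · have := hρ (C X)
    simpa [g, hh] using this
  · have := hρ X
    simpa [g, hh] using this

end FieldPlace

section Dedekind

variable {C L : Type*} [CommRing C] [IsDedekindDomain C] [Field L] [Algebra C L]
  [IsFractionRing C L] {W : ValuationSubring L}

open IsDedekindDomain

/-- A nontrivial valuation ring containing a Dedekind domain is the valuation ring of a prime. -/
lemma exists_heightOneSpectrum_of_valuationSubring (hW : W ≠ ⊤)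
    (hC : ∀ c : C, algebraMap C L c ∈ W) :
    ∃ P : HeightOneSpectrum C, (∀ c : C, c ∈ P.asIdeal ↔ W.valuation (algebraMap C L c) < 1) ∧
      ∀ x : L, x ∈ W ↔ P.valuation L x ≤ 1 := by
  let j : C →+* W := (algebraMap C L).codRestrict W hC
  let P₀ : Ideal C := (IsLocalRing.maximalIdeal W).comap j
  have hP₀ : ∀ c : C, c ∈ P₀ ↔ W.valuation (algebraMap C L c) < 1 := fun c => by
    rw [Ideal.mem_comap, W.valuation_lt_one_iff]
    rfl
  have hbot : P₀ ≠ ⊥ := by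
    intro h
    apply hW
    rw [eq_top_iff]
    intro x _
    obtain ⟨a, b, hb, rfl⟩ := IsFractionRing.div_surjective (A := C) x
    have hb1 : ¬ W.valuation (algebraMap C L b) < 1 := by
      rw [← hP₀, h, Ideal.mem_bot]
      exact nonZeroDivisors.ne_zero hb
    have hb2 := le_antisymm ((W.valuation_le_one_iff _).2 (hC b)) (not_lt.1 hb1)
    rw [← W.valuation_le_one_iff, map_div₀, hb2, div_one, W.valuation_le_one_iff]
    exact hC a
  let P : HeightOneSpectrum C := ⟨P₀, inferInstance, hbot⟩
  have hle : ∀ x : L, P.valuation L x ≤ 1 → x ∈ W := by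
    intro x hx
    obtain ⟨n, d, hnd⟩ := P.exists_primeCompl_mul_eq_of_integer x hx
    have hd : W.valuation (algebraMap C L d) = 1 :=
      le_antisymm ((W.valuation_le_one_iff _).2 (hC _)) (not_lt.1 fun h => d.2 ((hP₀ _).2 h))
    have h1 := congrArg W.valuation hnd
    rw [map_mul, hd, mul_one] at h1
    rw [← W.valuation_le_one_iff, h1, W.valuation_le_one_iff]
    exact hC n
  have hlt : ∀ x : L, P.valuation L x < 1 → W.valuation x < 1 := by
    intro x hx
    obtain ⟨n, d, hnd⟩ := P.exists_primeCompl_mul_eq_of_integer x hx.le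
    have hd : W.valuation (algebraMap C L d) = 1 :=
      le_antisymm ((W.valuation_le_one_iff _).2 (hC _)) (not_lt.1 fun h => d.2 ((hP₀ _).2 h))
    have hd' : P.valuation L (algebraMap C L d) = 1 := P.valuation_eq_one_iff_notMem.2 d.2
    have h1 := congrArg W.valuation hnd
    have h2 := congrArg (P.valuation L) hnd
    rw [map_mul, hd, mul_one] at h1
    rw [map_mul, hd', mul_one] at h2
    rw [h1, ← hP₀]
    rw [h2] at hx
    exact (P.valuation_lt_one_iff_mem n).1 hx
  refine ⟨P, hP₀, fun x => ⟨fun hx => ?_, hle x⟩⟩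
  by_contra! h
  have h1 : P.valuation L x⁻¹ < 1 := by
    rw [map_inv₀]
    exact inv_lt_one_of_one_lt₀ h
  have h2 := hlt _ h1
  have h0 : x ≠ 0 := by rintro rfl; simp at h
  have h3 : W.valuation x * W.valuation x⁻¹ < 1 :=
    (mul_le_of_le_one_left' ((W.valuation_le_one_iff _).2 hx)).trans_lt h2
  rw [← map_mul, mul_inv_cancel₀ h0, map_one] at h3
  exact lt_irrefl _ h3

/-- An element which generates the maximal ideal of a valuation ring. -/
def IsUnif (W : ValuationSubring L) (π : L) : Prop :=
  π ≠ 0 ∧ W.valuation π < 1 ∧ ∀ x, W.valuation x < 1 → W.valuation x ≤ W.valuation π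

variable (C) in
lemma exists_isUnif (hW : W ≠ ⊤) (hC : ∀ c : C, algebraMap C L c ∈ W) : ∃ π, IsUnif W π := by
  obtain ⟨P, hP, hPW⟩ := exists_heightOneSpectrum_of_valuationSubring hW hC
  obtain ⟨π, hπ⟩ : ∃ π : C, P.valuation L (algebraMap C L π) = WithZero.exp (-1) :=
    P.valuation_exists_uniformizer' L
  have hmem : π ∈ P.asIdeal := by
    rw [← P.valuation_lt_one_iff_mem (K := L), hπ, ← WithZero.exp_zero, WithZero.exp_lt_exp]
    norm_num
  have hπ0 : algebraMap C L π ≠ 0 := by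
    intro h
    rw [h, map_zero] at hπ
    exact WithZero.exp_ne_zero hπ.symm
  refine ⟨algebraMap C L π, hπ0, (hP _).1 hmem, fun x hx => ?_⟩
  rcases eq_or_ne x 0 with rfl | hx0
  · simp
  have hpos : 0 < W.valuation (algebraMap C L π) := by rwa [zero_lt_iff, Valuation.ne_zero_iff]
  have h1 : P.valuation L x < 1 := by
    by_contra! h
    have : x⁻¹ ∈ W := (hPW _).2 (by rw [map_inv₀]; exact inv_le_one_of_one_le₀ h)
    have h3 : W.valuation x * W.valuation x⁻¹ < 1 :=
      (mul_le_of_le_one_right' ((W.valuation_le_one_iff _).2 this)).trans_lt hx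
    rw [← map_mul, mul_inv_cancel₀ hx0, map_one] at h3
    exact lt_irrefl _ h3
  rw [← div_le_one₀ hpos, ← map_div₀, W.valuation_le_one_iff, hPW, map_div₀, hπ,
    div_le_one₀ (WithZero.exp_pos)]
  have hx1 : P.valuation L x ≠ 0 := by rwa [Valuation.ne_zero_iff]
  rw [← WithZero.log_le_iff_le_exp hx1]
  rw [← WithZero.exp_zero, ← WithZero.log_lt_iff_lt_exp hx1] at h1
  omega

variable {k : Type*} [Field k] [CharZero k] [Algebra k[X] C] [Algebra k[X] L]
  [IsScalarTower k[X] C L] [Module.Finite k[X] C]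

lemma isUnramifiedAt_of_isUnif (hC : ∀ c : C, algebraMap C L c ∈ W) 
    (hX : IsUnif W (algebraMap k[X] L X)) :
    ∃ (P : Ideal C) (_ : P.IsPrime), (∀ c : C, c ∈ P ↔ W.valuation (algebraMap C L c) < 1) ∧
      Algebra.IsUnramifiedAt k[X] P := by
  have hW : W ≠ ⊤ := by
    rintro rfl
    have : (algebraMap k[X] L X)⁻¹ ∈ (⊤ : ValuationSubring L) := trivial
    rw [← ValuationSubring.valuation_le_one_iff, map_inv₀, inv_le_one₀] at this
    · exact absurd this (not_le.2 hX.2.1)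
    · rw [zero_lt_iff, Valuation.ne_zero_iff]
      exact hX.1
  obtain ⟨P, hP, hPW⟩ := exists_heightOneSpectrum_of_valuationSubring hW hC
  refine ⟨P.asIdeal, inferInstance, hP, ?_⟩
  let p := P.asIdeal.under k[X]
  let := Localization.AtPrime.algebraOfLiesOver p P.asIdeal
  rw [Algebra.isUnramifiedAt_iff_map_eq k[X] p P.asIdeal]
  constructor
  · have : CharZero p.ResidueField :=
      charZero_of_injective_ringHom
        ((algebraMap k[X] p.ResidueField).comp (Polynomial.C : k →+* k[X])).injective
    infer_instance
  · apply le_antisymm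
    · rw [← Localization.AtPrime.map_eq_maximalIdeal, IsScalarTower.algebraMap_eq k[X] C,
        ← Ideal.map_map]
      exact Ideal.map_mono Ideal.map_comap_le
    · rw [← Localization.AtPrime.map_eq_maximalIdeal, Ideal.map_le_iff_le_comap]
      intro n hn
      have hpos : 0 < W.valuation (algebraMap k[X] L X) := by
        rw [zero_lt_iff, Valuation.ne_zero_iff]
        exact hX.1
      have h1 : algebraMap C L n / algebraMap k[X] L X ∈ W := by
        rw [← W.valuation_le_one_iff, map_div₀, div_le_one₀ hpos]
        exact hX.2.2 _ ((hP n).1 hn)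
      obtain ⟨n', d, hnd⟩ := P.exists_primeCompl_mul_eq_of_integer _ ((hPW _).1 h1)
      have h2 : n * d = algebraMap k[X] C X * n' := by
        apply IsFractionRing.injective C L
        rw [map_mul, map_mul, ← hnd, ← IsScalarTower.algebraMap_apply]
        have := hX.1
        field_simp
      have hXp : (X : k[X]) ∈ p := by
        rw [Ideal.mem_comap, hP, ← IsScalarTower.algebraMap_apply]
        exact hX.2.1
      have hd : IsUnit (algebraMap C (Localization.AtPrime P.asIdeal) d) :=
        IsLocalization.map_units _ d
      rw [Ideal.mem_comap, ← Ideal.mul_unit_mem_iff_mem _ hd, ← map_mul, h2, map_mul,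
        ← IsScalarTower.algebraMap_apply]
      exact Ideal.mul_mem_right _ _ (Ideal.mem_map_of_mem _ hXp)

end Dedekind

section Coordinate

variable {C L : Type*} [CommRing C] [IsDedekindDomain C] [Field L] [Algebra C L]
  [IsFractionRing C L] {W : ValuationSubring L} {k : Type*} [Field k] [Algebra k[X] L] [Algebra k L]
  [IsScalarTower k k[X] L]

lemma bivEval_algebraMap_X (θ : L) (p : k[X][X]) :
    bivEval (algebraMap k L) (algebraMap k[X] L X) θ p = aeval θ p := by
  rw [aeval_def, bivEval, coe_eval₂RingHom]
  congr 1
  refine Polynomial.ringHom_ext' ?_ ?_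
  · ext a
    simp [IsScalarTower.algebraMap_apply k k[X] L]
  · simp

lemma valuation_eq_one_of_isUnit {S : Type*} [CommRing S] (ψ : S →+* L) (hψ : ∀ x, ψ x ∈ W)
    {x : S} (hx : IsUnit x) : W.valuation (ψ x) = 1 := by
  obtain ⟨y, hy⟩ := hx.exists_right_inv
  have h := congrArg (fun z => W.valuation (ψ z)) hy
  simp only [map_mul, map_one] at h
  refine le_antisymm ((W.valuation_le_one_iff _).2 (hψ x)) ?_
  rw [← h]
  exact mul_le_of_le_one_right' ((W.valuation_le_one_iff _).2 (hψ y))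

lemma exists_eq_div_of_mem_closure {R : Type*} [CommRing R] (e : R →+* L) {x : L}
    (hx : x ∈ Subfield.closure (e.range : Set L)) : ∃ p q, e q ≠ 0 ∧ x = e p / e q := by
  rw [Subfield.mem_closure_iff, Subring.closure_eq] at hx
  obtain ⟨_, ⟨p, rfl⟩, _, ⟨q, rfl⟩, rfl⟩ := hx
  by_cases hq : e q = 0
  · exact ⟨0, 1, by simp, by simp [hq]⟩
  · exact ⟨p, q, hq, rfl⟩

variable [CharZero k] [Algebra k[X] C] [IsScalarTower k[X] C L] [Module.Finite k[X] C]
  [FaithfulSMul k[X] L]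

/-- At a place with uniformizer `π`, the curve has a plane model with coordinates `π, θ` which is
smooth at the place. -/
lemma exists_smooth_coordinate (hC : ∀ c : C, algebraMap C L c ∈ W)
    (hX : IsUnif W (algebraMap k[X] L X)) :
    ∃ θ ∈ W, ∃ f : k[X][X], bivEval (algebraMap k L) (algebraMap k[X] L X) θ f = 0 ∧
      W.valuation (bivEval (algebraMap k L) (algebraMap k[X] L X) θ (derivative f)) = 1 ∧
      (∀ p, bivEval (algebraMap k L) (algebraMap k[X] L X) θ p = 0 → f ∣ p) ∧
      ∀ x : L, ∃ p q : k[X][X], bivEval (algebraMap k L) (algebraMap k[X] L X) θ q ≠ 0 ∧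
        x = bivEval (algebraMap k L) (algebraMap k[X] L X) θ p /
          bivEval (algebraMap k L) (algebraMap k[X] L X) θ q := by
  obtain ⟨P, _, hP, _⟩ := isUnramifiedAt_of_isUnif (k := k) hC hX
  obtain ⟨s, hs, E, φ, hφ⟩ :=
    Algebra.IsUnramifiedAt.exists_hasStandardEtaleSurjectionOn (R := k[X]) P
  have hs1 : W.valuation (algebraMap C L s) = 1 :=
    le_antisymm ((W.valuation_le_one_iff _).2 (hC s)) (not_lt.1 fun h => hs ((hP s).2 h))
  have hs0 : algebraMap C L s ≠ 0 := fun h => by simp [h] at hs1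
  let ψ : Localization.Away s →ₐ[C] L :=
    { IsLocalization.Away.lift (S := Localization.Away s) s (g := algebraMap C L) hs0.isUnit with
      commutes' := fun r => IsLocalization.Away.lift_eq s hs0.isUnit r }
  have hψ : ∀ x, ψ x ∈ W := by
    intro x
    obtain ⟨n, a, ha⟩ := IsLocalization.Away.surj s x
    have h1 := congrArg (fun z => W.valuation (ψ z)) ha
    simp only [map_mul, map_pow, AlgHom.commutes, hs1, one_pow, mul_one] at h1
    rw [← W.valuation_le_one_iff, h1, W.valuation_le_one_iff]
    exact hC a
  let χ : E.Ring →ₐ[k[X]] L := (ψ.restrictScalars k[X]).comp φ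
  have hχ : ∀ x, χ x ∈ W := fun x => hψ _
  have hmap : E.HasMap (χ E.X) := E.hasMap_X.map χ
  have hd : W.valuation (aeval (χ E.X) (derivative E.f)) = 1 := by
    rw [aeval_algHom_apply]
    exact valuation_eq_one_of_isUnit χ.toRingHom hχ E.hasMap_X.isUnit_derivative_f
  set θ := χ E.X with hθ
  have hint : IsIntegral k[X] θ := ⟨E.f, E.monic_f, hmap.1⟩
  have hmem : ∀ p : k[X][X], aeval θ p ∈ W := fun p => by
    rw [hθ, aeval_algHom_apply]
    exact hχ _
  refine ⟨θ, hχ _, minpoly k[X] θ, ?_⟩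
  simp only [bivEval_algebraMap_X]
  refine ⟨minpoly.aeval _ _, ?_, fun p hp => minpoly.isIntegrallyClosed_dvd hint hp, ?_⟩
  · obtain ⟨r, hr⟩ := minpoly.isIntegrallyClosed_dvd hint hmap.1
    rw [hr, derivative_mul, map_add, map_mul, map_mul, minpoly.aeval, zero_mul, add_zero,
      map_mul] at hd
    refine le_antisymm ((W.valuation_le_one_iff _).2 (hmem _)) ?_
    rw [← hd]
    exact mul_le_of_le_one_right' ((W.valuation_le_one_iff _).2 (hmem _))
  · let T : Subfield L := Subfield.closure ((aeval (R := k[X]) θ : k[X][X] →+* L).range : Set L)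
    have hT : ∀ p : k[X][X], aeval θ p ∈ T := fun p => Subfield.subset_closure ⟨p, rfl⟩
    let _ : Algebra k[X] T :=
      ((algebraMap k[X] L).codRestrict T fun p => by simpa using hT (Polynomial.C p)).toAlgebra
    let ι : T →ₐ[k[X]] L := { T.subtype with commutes' := fun r => rfl }
    have hθT : E.HasMap (⟨θ, by simpa using hT X⟩ : T) := by
      have hι : ∀ p : k[X][X], ι (aeval (⟨θ, by simpa using hT X⟩ : T) p) = aeval θ p := fun p => by
        rw [← aeval_algHom_apply]
        rfl
      refine ⟨ι.toRingHom.injective ?_, ?_⟩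
      · exact (hι _).trans (hmap.1.trans (map_zero ι).symm)
      · rw [isUnit_iff_ne_zero]
        intro h
        refine hmap.2.ne_zero ?_
        rw [← hι, h, map_zero]
    have hχT : χ = ι.comp (E.lift _ hθT) := by
      apply StandardEtalePair.hom_ext
      rw [AlgHom.comp_apply ι, StandardEtalePair.lift_X]
      rfl
    have hCT : ∀ c : C, algebraMap C L c ∈ T := by
      intro c
      obtain ⟨r, hr⟩ := hφ (algebraMap C _ c)
      have : algebraMap C L c = χ r := by
        rw [AlgHom.comp_apply, hr]
        exact (ψ.commutes c).symm
      rw [this, hχT]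
      exact Subtype.prop _
    intro x
    obtain ⟨a, b, -, rfl⟩ := IsFractionRing.div_surjective (A := C) x
    exact exists_eq_div_of_mem_closure _ (div_mem (hCT a) (hCT b))

end Coordinate

section IntegralModel

open scoped IntermediateField

variable {k L : Type*} [Field k] [Field L] [Algebra k L] {W : ValuationSubring L}

lemma integralClosure_polynomial [CharZero k] [Algebra k[X] L] [IsScalarTower k k[X] L]
    [FaithfulSMul k[X] L]
    (hfin : FiniteDimensional k⟮algebraMap k[X] L X⟯ L) :
    IsDedekindDomain (integralClosure k[X] L) ∧ IsFractionRing (integralClosure k[X] L) L ∧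
      Module.Finite k[X] (integralClosure k[X] L) ∧ Algebra.IsAlgebraic k[X] L := by
  set a := algebraMap k[X] L X with ha
  have haeval : ∀ p : k[X], aeval a p = algebraMap k[X] L p := fun p => by
    rw [ha, aeval_algebraMap_apply, aeval_X_left_apply]
  let _ : Algebra k[X] k⟮a⟯ :=
    ((algebraMap k[X] L).codRestrict k⟮a⟯ fun p => by
      rw [← haeval]
      exact (IntermediateField.mem_adjoin_simple_iff k _).2 ⟨p, 1, by simp⟩).toAlgebra
  have : IsScalarTower k[X] k⟮a⟯ L := IsScalarTower.of_algebraMap_eq fun p => rfl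
  have : FaithfulSMul k[X] k⟮a⟯ := by
    rw [faithfulSMul_iff_algebraMap_injective]
    intro p q h
    exact FaithfulSMul.algebraMap_injective k[X] L (congrArg Subtype.val h)
  have : IsFractionRing k[X] k⟮a⟯ := by
    refine IsFractionRing.of_field _ _ fun z => ?_
    obtain ⟨r, s, hrs⟩ := (IntermediateField.mem_adjoin_simple_iff k _).1 z.2
    refine ⟨r, s, Subtype.ext ?_⟩
    rw [hrs, haeval, haeval]
    rfl
  refine ⟨integralClosure.isDedekindDomain k[X] k⟮a⟯ L,
    integralClosure.isFractionRing_of_finite_extension k⟮a⟯ L,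
    IsIntegralClosure.finite k[X] k⟮a⟯ L _, ?_⟩
  rw [IsFractionRing.comap_isAlgebraic_iff (A := k[X]) (K := k⟮a⟯) (C := L)]
  infer_instance

lemma algebra_polynomial_of_transcendental {a : L} (ha : Transcendental k a) :
    ∃ _ : Algebra k[X] L, IsScalarTower k k[X] L ∧ FaithfulSMul k[X] L ∧
      algebraMap k[X] L X = a := by
  let _ : Algebra k[X] L := (aeval a).toRingHom.toAlgebra
  refine ⟨inferInstance, IsScalarTower.of_algebraMap_eq fun c => ?_, ?_, ?_⟩
  · exact (aeval_C a c).symm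
  · rw [faithfulSMul_iff_algebraMap_injective]
    exact transcendental_iff_injective.1 ha
  · exact aeval_X a

lemma exists_bivEval_eq_zero [CharZero k]
    (hfin : ∀ a : L, Transcendental k a → FiniteDimensional k⟮a⟯ L)
    (a z : L) (ha : Transcendental k a) :
    ∃ p : k[X][X], p ≠ 0 ∧ bivEval (algebraMap k L) a z p = 0 := by
  obtain ⟨_, _, _, rfl⟩ := algebra_polynomial_of_transcendental ha
  obtain ⟨-, -, -, h⟩ := integralClosure_polynomial (hfin _ ha)
  obtain ⟨p, hp, hp0⟩ := h.isAlgebraic z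
  exact ⟨p, hp, by rw [bivEval_algebraMap_X, hp0]⟩

lemma algebraMap_polynomial_mem [Algebra k[X] L] [IsScalarTower k k[X] L]
    (hk : ∀ c : k, algebraMap k L c ∈ W) (hX : algebraMap k[X] L X ∈ W) (p : k[X]) :
    algebraMap k[X] L p ∈ W := by
  have := aeval_mem_valuationSubring hk hX p
  rwa [aeval_algebraMap_apply, aeval_X_left_apply] at this

lemma mem_of_isIntegral_of_mem {R : Type*} [CommRing R] [Algebra R L]
    (hR : ∀ c : R, algebraMap R L c ∈ W) {x : L} (hx : IsIntegral R x) : x ∈ W := by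
  obtain ⟨p, hp, hpx⟩ := hx
  have : IsIntegral W x := by
    refine ⟨p.map ((algebraMap R L).codRestrict W hR), hp.map _, ?_⟩
    rw [eval₂_map]
    exact hpx
  obtain ⟨y, rfl⟩ := IsIntegrallyClosed.isIntegral_iff.1 this
  exact y.2

lemma exists_isUnif_of_finiteDimensional [CharZero k]
    (hfin : ∀ a : L, Transcendental k a → FiniteDimensional k⟮a⟯ L)
    (hk : ∀ c : k, algebraMap k L c ∈ W) (hW : W ≠ ⊤) : ∃ π, IsUnif W π := by
  obtain ⟨x, hx⟩ : ∃ x, x ∉ W := by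
    by_contra! h
    exact hW (eq_top_iff.2 fun x _ => h x)
  rw [← W.valuation_le_one_iff, not_le] at hx
  have hx0 : x ≠ 0 := by rintro rfl; simp at hx
  have hlt : W.valuation x⁻¹ < 1 := by
    rw [map_inv₀]
    exact inv_lt_one_of_one_lt₀ hx
  have ht := transcendental_of_valuation_lt_one hk hlt (inv_ne_zero hx0)
  obtain ⟨_, _, _, hX⟩ := algebra_polynomial_of_transcendental ht
  rw [← hX] at hlt ht
  obtain ⟨_, _, -, -⟩ := integralClosure_polynomial (hfin _ ht)
  exact exists_isUnif (integralClosure k[X] L) hW fun c => mem_of_isIntegral_of_mem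
    (algebraMap_polynomial_mem hk ((W.valuation_le_one_iff _).1 hlt.le)) c.2

lemma exists_smooth_coordinate_of_finiteDimensional [CharZero k]
    (hfin : ∀ a : L, Transcendental k a → FiniteDimensional k⟮a⟯ L)
    (hk : ∀ c : k, algebraMap k L c ∈ W) {π : L} (hπ : IsUnif W π) :
    ∃ θ ∈ W, ∃ f : k[X][X], bivEval (algebraMap k L) π θ f = 0 ∧
      W.valuation (bivEval (algebraMap k L) π θ (derivative f)) = 1 ∧
      (∀ p, bivEval (algebraMap k L) π θ p = 0 → f ∣ p) ∧
      ∀ x : L, ∃ p q : k[X][X], bivEval (algebraMap k L) π θ q ≠ 0 ∧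
        x = bivEval (algebraMap k L) π θ p / bivEval (algebraMap k L) π θ q := by
  have ht := transcendental_of_valuation_lt_one hk hπ.2.1 hπ.1
  obtain ⟨_, _, _, rfl⟩ := algebra_polynomial_of_transcendental ht
  obtain ⟨_, _, _, -⟩ := integralClosure_polynomial (hfin _ ht)
  exact exists_smooth_coordinate (C := integralClosure k[X] L) (fun c => mem_of_isIntegral_of_mem
    (algebraMap_polynomial_mem hk ((W.valuation_le_one_iff _).1 hπ.2.1.le)) c.2) hπ

end IntegralModel

section Decomposition

variable {K L : Type*} [Field K] [Field L] [Algebra K L] {B : ValuationSubring L}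

lemma apply_mem_iff_of_mem_decompositionSubgroup {σ : L ≃ₐ[K] L}
    (hσ : σ ∈ B.decompositionSubgroup K) {x : L} : σ x ∈ B ↔ x ∈ B := by
  have h : σ • B = B := hσ
  have h' := ValuationSubring.smul_mem_pointwise_smul_iff (g := σ) (S := B) (x := x)
  rwa [h] at h'

lemma valuation_apply_lt_one_iff {σ : L ≃ₐ[K] L}
    (hσ : σ ∈ B.decompositionSubgroup K) {x : L} : B.valuation (σ x) < 1 ↔ B.valuation x < 1 := by
  rcases eq_or_ne x 0 with rfl | hx
  · simp
  have key : ∀ y : L, y ≠ 0 → (B.valuation y < 1 ↔ y⁻¹ ∉ B) := fun y hy => by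
    have hpos : 0 < B.valuation y := by rwa [zero_lt_iff, Valuation.ne_zero_iff]
    rw [← B.valuation_le_one_iff, map_inv₀, not_le, one_lt_inv₀ hpos]
  rw [key _ hx, key _ (by simpa using hx), ← map_inv₀,
    apply_mem_iff_of_mem_decompositionSubgroup hσ]

/-- At a place with trivial inertia there is a uniformizer fixed by the decomposition group. -/
lemma exists_isUnif_fixed [Finite (L ≃ₐ[K] L)] (hB : B.inertiaSubgroup K = ⊥) {ϖ : L}
    (hϖ : IsUnif B ϖ) :
    ∃ π, IsUnif B π ∧ ∀ σ ∈ B.decompositionSubgroup K, σ π = π := by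
  classical
  let D := B.decompositionSubgroup K
  have := Fintype.ofFinite D
  have hpos : 0 < B.valuation ϖ := by
    rw [zero_lt_iff, Valuation.ne_zero_iff]
    exact hϖ.1
  have hu : ∀ σ : D, (σ : L ≃ₐ[K] L) ϖ / ϖ ∈ B := fun σ => by
    rw [← B.valuation_le_one_iff, map_div₀, div_le_one₀ hpos]
    exact hϖ.2.2 _ ((valuation_apply_lt_one_iff σ.2).2 hϖ.2.1)
  let u : D → IsLocalRing.ResidueField B := fun σ => IsLocalRing.residue B ⟨_, hu σ⟩
  let s : D → IsLocalRing.ResidueField B →* IsLocalRing.ResidueField B := fun σ =>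
    (MulSemiringAction.toRingAut D (IsLocalRing.ResidueField B) σ : _ →* _)
  have hs : Function.Injective s := by
    intro σ τ h
    apply (MonoidHom.ker_eq_bot_iff _).1 hB
    ext x
    exact DFunLike.congr_fun h x
  have hlin := (linearIndependent_monoidHom (IsLocalRing.ResidueField B)
    (IsLocalRing.ResidueField B)).comp s hs
  rw [Fintype.linearIndependent_iff] at hlin
  have hu1 : u 1 ≠ 0 := by
    have : (⟨_, hu 1⟩ : B) = 1 := Subtype.ext (by simpa using div_self hϖ.1)
    change IsLocalRing.residue B ⟨_, hu 1⟩ ≠ 0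
    rw [this, map_one]
    exact one_ne_zero
  obtain ⟨a, ha⟩ : ∃ a : IsLocalRing.ResidueField B, ∑ σ, u σ * s σ a ≠ 0 := by
    by_contra! h
    refine hu1 (hlin u (funext fun a => ?_) 1)
    simpa [Finset.sum_apply] using h a
  obtain ⟨a, rfl⟩ := IsLocalRing.residue_surjective a
  have hsum : ∑ σ, u σ * s σ (IsLocalRing.residue B a) = IsLocalRing.residue B
      (∑ σ : D, ⟨_, hu σ⟩ * σ • a) := by
    rw [map_sum]
    refine Finset.sum_congr rfl fun σ _ => ?_
    rw [map_mul]
    rfl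
  rw [hsum, Ne, residue_eq_zero_iff_valuation] at ha
  have ha1 := le_antisymm ((B.valuation_le_one_iff _).2 (Subtype.prop _)) (not_lt.1 ha)
  refine ⟨∑ σ : D, (σ : L ≃ₐ[K] L) (a * ϖ), ?_, fun σ hσ => ?_⟩
  · have hv : B.valuation (∑ σ : D, (σ : L ≃ₐ[K] L) (a * ϖ)) = B.valuation ϖ := by
      have : ∑ σ : D, (σ : L ≃ₐ[K] L) (a * ϖ) =
          ((∑ σ : D, ⟨_, hu σ⟩ * σ • a : B) : L) * ϖ := by
        have h := map_sum B.subtype (fun σ : D => ⟨_, hu σ⟩ * σ • a) Finset.univ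
        change ((∑ σ : D, ⟨_, hu σ⟩ * σ • a : B) : L) = _ at h
        rw [h, Finset.sum_mul]
        refine Finset.sum_congr rfl fun σ _ => ?_
        change _ = (σ : L ≃ₐ[K] L) ϖ / ϖ * (σ : L ≃ₐ[K] L) a * ϖ
        have := hϖ.1
        rw [map_mul]
        field_simp
      rw [this, map_mul, ha1, one_mul]
    refine ⟨?_, hv.trans_lt hϖ.2.1, fun x hx => (hϖ.2.2 x hx).trans_eq hv.symm⟩
    rw [← Valuation.ne_zero_iff B.valuation, hv, Valuation.ne_zero_iff]
    exact hϖ.1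
  · rw [map_sum]
    exact Fintype.sum_equiv (Equiv.mulLeft (⟨σ, hσ⟩ : D)) _ _ fun τ => rfl

end Decomposition

section Implicit

open Filter Topology

lemma hasStrictFDerivAt_bivEval {k F : Type*} [CommRing k] [NontriviallyNormedField F]
    (i : k →+* F) (p : k[X][X]) (v : F × F) :
    ∃ D : F × F →L[F] F, HasStrictFDerivAt (fun v : F × F => bivEval i v.1 v.2 p) D v ∧
      D (0, 1) = bivEval i v.1 v.2 (derivative p) := by
  induction p using Polynomial.induction_on' with
  | add p q hp hq =>
    obtain ⟨D, hD, hD'⟩ := hp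
    obtain ⟨E, hE, hE'⟩ := hq
    refine ⟨D + E, ?_, ?_⟩
    · simpa only [map_add] using! hD.add hE
    · simp [hD', hE']
  | monomial n q =>
    have h1 := ((q.map i).hasStrictDerivAt v.1).comp_hasStrictFDerivAt v
      (hasStrictFDerivAt_fst (𝕜 := F))
    have h2 := (hasStrictDerivAt_pow n v.2).comp_hasStrictFDerivAt v
      (hasStrictFDerivAt_snd (𝕜 := F))
    have h3 := h1.mul h2
    refine ⟨_, h3.congr_of_eventuallyEq (Eventually.of_forall fun w => ?_), ?_⟩
    · simp only [← C_mul_X_pow_eq_monomial, map_mul, map_pow, bivEval_C, bivEval_X,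
        Pi.mul_apply, Function.comp_apply, eval_map]
    · simp [← C_mul_X_pow_eq_monomial, eval_map, derivative_X_pow]

lemma continuous_bivEval {k F : Type*} [CommRing k] [NontriviallyNormedField F]
    (i : k →+* F) (p : k[X][X]) : Continuous (fun v : F × F => bivEval i v.1 v.2 p) :=
  continuous_iff_continuousAt.2 fun v =>
    (hasStrictFDerivAt_bivEval i p v).choose_spec.1.continuousAt

lemma tendsto_bivEval_of_tendsto {k F X : Type*} [CommRing k] [NontriviallyNormedField F]
    (i : k →+* F) {l : Filter X} {g h : X → F} {a b : F} (hg : Tendsto g l (𝓝 a))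
    (hh : Tendsto h l (𝓝 b)) (p : k[X][X]) :
    Tendsto (fun c => bivEval i (g c) (h c) p) l (𝓝 (bivEval i a b p)) := by
  have h2 := (continuous_bivEval i p).tendsto (a, b)
  exact Tendsto.comp h2 (hg.prodMk_nhds hh)

variable {k F : Type*} [NontriviallyNormedField k] [NontriviallyNormedField F] [NormedAlgebra k F]

lemma tendsto_bivEval {h : k → F} {b : F} (hh : Tendsto h (𝓝 0) (𝓝 b)) (p : k[X][X]) :
    Tendsto (fun c => bivEval (algebraMap k F) (algebraMap k F c) (h c) p) (𝓝 0)
      (𝓝 (bivEval (algebraMap k F) 0 b p)) := by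
  have hi : Tendsto (algebraMap k F) (𝓝 0) (𝓝 0) := by
    have := (continuous_algebraMap k F).tendsto 0
    rwa [map_zero] at this
  exact tendsto_bivEval_of_tendsto (algebraMap k F) hi hh p

/-- The implicit function theorem for a polynomial in two variables. -/
lemma exists_implicit_bivEval [CompleteSpace F] {f : k[X][X]} {b : F}
    (hf : bivEval (algebraMap k F) 0 b f = 0)
    (hf' : bivEval (algebraMap k F) 0 b (derivative f) ≠ 0) :
    ∃ h : k → F, Tendsto h (𝓝 0) (𝓝 b) ∧
      (∀ᶠ c in 𝓝 0, bivEval (algebraMap k F) (algebraMap k F c) (h c) f = 0) ∧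
      ∀ h' : k → F, Tendsto h' (𝓝 0) (𝓝 b) →
        ∀ᶠ c in 𝓝 0, bivEval (algebraMap k F) (algebraMap k F c) (h' c) f = 0 → h' c = h c := by
  obtain ⟨D, hD, hD'⟩ := hasStrictFDerivAt_bivEval (algebraMap k F) f (0, b)
  have hinv : (D ∘L .inr F F F).IsInvertible := by
    refine ⟨ContinuousLinearEquiv.unitsEquivAut F (Units.mk0 _ hf'), ?_⟩
    ext
    simp [hD']
  have hc : Tendsto (algebraMap k F) (𝓝 0) (𝓝 0) := by
    have := (continuous_algebraMap k F).tendsto 0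
    rwa [map_zero] at this
  refine ⟨fun c => hD.implicitFunctionOfProdDomain hinv (algebraMap k F c),
    (hD.tendsto_implicitFunctionOfProdDomain hinv).comp hc, ?_, fun h' hh' => ?_⟩
  · filter_upwards [hc.eventually (hD.eventually_apply_implicitFunctionOfProdDomain hinv)] with c h
    exact h.trans hf
  · have h1 : Tendsto (fun c : k => (algebraMap k F c, h' c)) (𝓝 0) (𝓝 (0, b)) := hc.prodMk_nhds hh'
    filter_upwards [h1.eventually
      (hD.eventually_apply_eq_iff_implicitFunctionOfProdDomain hinv)] with c h h0
    exact (h.1 (h0.trans hf.symm)).symm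

end Implicit

section

open Filter Topology

lemma mem_decompositionSubgroup_of_forall_mem {K L : Type*} [Field K] [Field L] [Algebra K L]
    [Finite (L ≃ₐ[K] L)] {B : ValuationSubring L} {σ : L ≃ₐ[K] L}
    (h : ∀ x ∈ B, σ x ∈ B) : σ ∈ B.decompositionSubgroup K := by
  have hpow : ∀ (n : ℕ), ∀ x ∈ B, (σ ^ n) x ∈ B := by
    intro n
    induction n with
    | zero => exact fun x hx => by simpa using hx
    | succ n ih =>
      intro x hx
      rw [pow_succ', AlgEquiv.mul_apply]
      exact h _ (ih x hx)
  have hle : σ⁻¹ ∈ Submonoid.powers σ :=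
    (mem_powers_iff_mem_zpowers (x := σ)).2 (inv_mem (Subgroup.mem_zpowers σ))
  obtain ⟨n, hn⟩ := hle
  rw [ValuationSubring.decompositionSubgroup, MulAction.mem_stabilizer_iff]
  ext x
  rw [ValuationSubring.mem_pointwise_smul_iff_inv_smul_mem]
  constructor
  · intro hx
    have := h _ hx
    rwa [← AlgEquiv.smul_def, smul_inv_smul] at this
  · intro hx
    have h1 := hpow n x hx
    simp only at hn
    rwa [hn] at h1

lemma valuation_lt_one_iff_inv_notMem {L : Type*} [Field L] (W : ValuationSubring L) (x : L) :
    W.valuation x < 1 ↔ x = 0 ∨ x⁻¹ ∉ W := by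
  by_cases hx : x = 0
  · simp [hx]
  · rw [← W.valuation_le_one_iff, map_inv₀, not_le, one_lt_inv₀ (by simpa [zero_lt_iff] using hx)]
    simp [hx]

namespace FieldPlace

lemma valuation_lt_one_iff_of_comap_eq {K L : Type*} [Field K] [Field L] [Algebra K L]
    {W W' : ValuationSubring L} (h : W.comap (algebraMap K L) = W'.comap (algebraMap K L)) (x : K) :
    W.valuation (algebraMap K L x) < 1 ↔ W'.valuation (algebraMap K L x) < 1 := by
  have := SetLike.ext_iff.1 h x⁻¹
  simp only [ValuationSubring.mem_comap, map_inv₀] at this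
  rw [valuation_lt_one_iff_inv_notMem, valuation_lt_one_iff_inv_notMem, this]

variable {k K L F : Type*} [NontriviallyNormedField k] [Field K] [Field L] [Algebra k K]
  [Algebra k L] [Algebra K L] [IsScalarTower k K L]
  [NontriviallyNormedField F] [NormedAlgebra k F]

variable {P₀ : FieldPlace k L F} {f : k[X][X]} {π θ : L} {b : F} {h : k → F}

/-- Functions regular at a place have values at nearby places which vary continuously. -/
lemma exists_tendsto_val
    (halg : ∀ a z : L, Transcendental k a →
      ∃ p : k[X][X], p ≠ 0 ∧ _root_.bivEval (algebraMap k L) a z p = 0)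
    (hπt : Transcendental k π)
    (hf : _root_.bivEval (algebraMap k L) π θ f = 0)
    (hgen : ∀ x : L, ∃ p q : k[X][X], _root_.bivEval (algebraMap k L) π θ q ≠ 0 ∧
      x = _root_.bivEval (algebraMap k L) π θ p / _root_.bivEval (algebraMap k L) π θ q)
    (hπ : P₀.Val π 0) (hθ : P₀.Val θ b)
    (hf' : _root_.bivEval (algebraMap k F) 0 b (derivative f) ≠ 0)
    (hh : Tendsto h (𝓝 0) (𝓝 b)) {x : L} {y : F} (hx : P₀.Val x y) :
    ∃ Φ : k → F, Tendsto Φ (𝓝 0) (𝓝 y) ∧ ∀ᶠ c in 𝓝 0, ∀ P : FieldPlace k L F,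
      P.Val π (algebraMap k F c) → P.Val θ (h c) → P.Val x (Φ c) := by
  obtain ⟨p, q, hq, rfl⟩ := P₀.exists_eq_div_of_mem (c := 0) halg hπt hf hgen
    (by rwa [map_zero]) hθ (by rwa [map_zero]) hx.mem
  rw [map_zero] at hq
  have hp' := tendsto_bivEval hh p
  have hq' := tendsto_bivEval hh q
  rw [hx.unique ((hπ.bivEval hθ p).div (hπ.bivEval hθ q) hq)]
  refine ⟨_, hp'.div hq' hq, ?_⟩
  filter_upwards [hq'.eventually_ne hq] with c hc P h1 h2
  exact (h1.bivEval h2 p).div (h1.bivEval h2 q) hc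

/-- An automorphism in the decomposition group of a place acts on its values. -/
lemma exists_algHom_val (hsurj : ∀ y : F, ∃ x, P₀.Val x y) {σ : L ≃ₐ[K] L}
    (hσ : σ ∈ P₀.ring.decompositionSubgroup K) :
    ∃ s : F →ₐ[k] F, ∀ x y, P₀.Val (σ x) y → P₀.Val x (s y) := by
  have hσ' : ∀ x ∈ P₀.ring, σ.symm x ∈ P₀.ring := fun x hx => by
    rw [← apply_mem_iff_of_mem_decompositionSubgroup hσ]
    simpa using hx
  let g : P₀.ring →+* P₀.ring := ((σ.symm : L →+* L).comp P₀.ring.subtype).codRestrict P₀.ring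
    fun x => hσ' _ x.2
  have hφ : Function.Surjective P₀.toRingHom := fun y => by
    obtain ⟨x, hx, rfl⟩ := hsurj y
    exact ⟨_, rfl⟩
  have hker : RingHom.ker P₀.toRingHom ≤ RingHom.ker (P₀.toRingHom.comp g) := by
    intro x hx
    rw [RingHom.mem_ker] at hx ⊢
    rw [P₀.eq_zero_iff] at hx
    rw [RingHom.comp_apply, P₀.eq_zero_iff, ← valuation_apply_lt_one_iff hσ]
    convert hx
    exact σ.apply_symm_apply _
  let s : F →+* F := RingHom.liftOfSurjective P₀.toRingHom hφ ⟨P₀.toRingHom.comp g, hker⟩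
  have hs : ∀ x, s (P₀.toRingHom x) = P₀.toRingHom (g x) := fun x =>
    RingHom.liftOfRightInverse_comp_apply P₀.toRingHom _ _ ⟨P₀.toRingHom.comp g, hker⟩ x
  refine ⟨⟨s, fun c => ?_⟩, fun x y ⟨hx, hy⟩ => ⟨?_, ?_⟩⟩
  · change s (algebraMap k F c) = _
    rw [← P₀.map_algebraMap, hs]
    congr 1
    apply Subtype.ext
    change σ.symm (algebraMap k L c) = algebraMap k L c
    rw [IsScalarTower.algebraMap_apply k K L, AlgEquiv.commutes]
  · rwa [apply_mem_iff_of_mem_decompositionSubgroup hσ] at hx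
  · change _ = s y
    rw [← hy, hs]
    congr 1
    apply Subtype.ext
    change x = σ.symm (σ x)
    simp

/-- An automorphism moving a place moves all nearby places. -/
lemma eventually_notMem_decompositionSubgroup [FiniteDimensional k F]
    (hnorm : ∀ y y' : F, minpoly k y = minpoly k y' → ‖y‖ = ‖y'‖)
    (hval : ∀ x y, P₀.Val x y → ∃ Φ : k → F, Tendsto Φ (𝓝 0) (𝓝 y) ∧
      ∀ᶠ c in 𝓝 0, ∀ P : FieldPlace k L F,
        P.Val π (algebraMap k F c) → P.Val θ (h c) → P.Val x (Φ c))
    [Finite (L ≃ₐ[K] L)] {τ : L ≃ₐ[K] L} (hτ : τ ∉ P₀.ring.decompositionSubgroup K) :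
    ∀ᶠ c in 𝓝 0, ∀ P : FieldPlace k L F,
      P.Val π (algebraMap k F c) → P.Val θ (h c) → τ ∉ P.ring.decompositionSubgroup K := by
  obtain ⟨x, hx, hτx⟩ : ∃ x ∈ P₀.ring, τ x ∉ P₀.ring := by
    by_contra! H
    exact hτ (mem_decompositionSubgroup_of_forall_mem H)
  have hτx0 : τ x ≠ 0 := fun h0 => hτx (h0 ▸ P₀.ring.zero_mem)
  have hlt : P₀.ring.valuation (τ x)⁻¹ < 1 := by
    rw [valuation_lt_one_iff_inv_notMem, inv_inv]
    exact Or.inr hτx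
  obtain ⟨y, hy⟩ := exists_val hx
  obtain ⟨Φ, hΦ, hΦ'⟩ := hval _ _ hy
  obtain ⟨Ψ, hΨ, hΨ'⟩ := hval _ _ (val_zero_of_lt hlt)
  have hlim : Tendsto (fun c => ‖Φ c‖ * ‖Ψ c‖) (𝓝 0) (𝓝 0) := by
    simpa using hΦ.norm.mul hΨ.norm
  filter_upwards [hΦ', hΨ', hlim.eventually_ne zero_ne_one] with c h1 h2 h3 P hπ hθ hτP
  have hxP := h1 P hπ hθ
  have hyP := h2 P hπ hθ
  have hx0 : x ≠ 0 := by rintro rfl; simp at hτx0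
  have hxinv : τ x⁻¹ ∈ P.ring := by rw [map_inv₀]; exact hyP.mem
  obtain ⟨v, hv⟩ := exists_val ((apply_mem_iff_of_mem_decompositionSubgroup hτP).1 hxinv)
  have hmul := hxP.mul hv
  rw [mul_inv_cancel₀ hx0] at hmul
  have hone := P.val_algebraMap 1
  rw [map_one, map_one] at hone
  have hmin : minpoly k v = minpoly k (Ψ c) := by
    refine hv.minpoly_eq hyP (Algebra.IsIntegral.isIntegral v) fun q hq => ?_
    rw [← map_inv₀]
    have := Polynomial.aeval_algHom_apply (τ.restrictScalars k).toAlgHom x⁻¹ q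
    have h4 : aeval (τ x⁻¹) q = τ (aeval x⁻¹ q) := this
    rw [h4, valuation_apply_lt_one_iff hτP]
    exact hq
  rw [← hnorm _ _ hmin, ← norm_mul, hmul.unique hone, norm_one] at h3
  exact h3 rfl

/-- An automorphism fixing a place and its parameter fixes all nearby places. -/
lemma eventually_mem_decompositionSubgroup
    (hnorm : ∀ y y' : F, minpoly k y = minpoly k y' → ‖y‖ = ‖y'‖)
    (halg : ∀ a z : L, Transcendental k a →
      ∃ p : k[X][X], p ≠ 0 ∧ _root_.bivEval (algebraMap k L) a z p = 0)
    (hπt : Transcendental k π)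
    (hf : _root_.bivEval (algebraMap k L) π θ f = 0)
    (hgen : ∀ x : L, ∃ p q : k[X][X], _root_.bivEval (algebraMap k L) π θ q ≠ 0 ∧
      x = _root_.bivEval (algebraMap k L) π θ p / _root_.bivEval (algebraMap k L) π θ q)
    (hθ : P₀.Val θ b)
    (hf' : _root_.bivEval (algebraMap k F) 0 b (derivative f) ≠ 0)
    (hh : Tendsto h (𝓝 0) (𝓝 b))
    (huniq : ∀ h' : k → F, Tendsto h' (𝓝 0) (𝓝 b) → ∀ᶠ c in 𝓝 0,
      _root_.bivEval (algebraMap k F) (algebraMap k F c) (h' c) f = 0 → h' c = h c)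
    (hval : ∀ x y, P₀.Val x y → ∃ Φ : k → F, Tendsto Φ (𝓝 0) (𝓝 y) ∧
      ∀ᶠ c in 𝓝 0, ∀ P : FieldPlace k L F,
        P.Val π (algebraMap k F c) → P.Val θ (h c) → P.Val x (Φ c))
    (hsurj : ∀ y : F, ∃ x, P₀.Val x y)
    [Finite (L ≃ₐ[K] L)] {σ : L ≃ₐ[K] L} (hσ : σ ∈ P₀.ring.decompositionSubgroup K)
    (hσπ : σ π = π) :
    ∀ᶠ c in 𝓝 0, ∀ P : FieldPlace k L F,
      P.Val π (algebraMap k F c) → P.Val θ (h c) → σ ∈ P.ring.decompositionSubgroup K := by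
  obtain ⟨s, hs⟩ := exists_algHom_val hsurj hσ
  have hscont : Continuous s := by
    refine (AddMonoidHomClass.isometry_of_norm s fun y => hnorm _ _ ?_).continuous
    exact minpoly.algHom_eq s s.toRingHom.injective y
  have hsbiv : ∀ c β (p : k[X][X]),
      s (_root_.bivEval (algebraMap k F) (algebraMap k F c) β p) =
        _root_.bivEval (algebraMap k F) (algebraMap k F c) (s β) p := by
    intro c β p
    have := map_bivEval s.toRingHom (algebraMap k F) (algebraMap k F c) β p
    simp only [AlgHom.toRingHom_eq_coe, RingHom.coe_coe, AlgHom.commutes,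
      AlgHom.comp_algebraMap] at this
    exact this
  have hσbiv : ∀ p : k[X][X], σ (_root_.bivEval (algebraMap k L) π θ p) =
      _root_.bivEval (algebraMap k L) π (σ θ) p := by
    intro p
    have := map_bivEval (σ.restrictScalars k : L →ₐ[k] L).toRingHom (algebraMap k L) π θ p
    simp only [AlgHom.toRingHom_eq_coe, RingHom.coe_coe, AlgHom.comp_algebraMap,
      AlgEquiv.coe_toAlgHom, AlgEquiv.coe_restrictScalars, hσπ] at this
    exact this
  obtain ⟨y, hy⟩ := exists_val ((apply_mem_iff_of_mem_decompositionSubgroup hσ).2 hθ.mem)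
  obtain ⟨Φ, hΦ, hΦ'⟩ := hval _ _ hy
  have hsb : s y = b := (hs _ _ hy).unique hθ
  have hsΦ : Tendsto (fun c => s (Φ c)) (𝓝 0) (𝓝 b) := by
    rw [← hsb]
    exact (hscont.tendsto y).comp hΦ
  filter_upwards [hΦ', huniq _ hsΦ, (tendsto_bivEval hh (derivative f)).eventually_ne hf']
    with c h1 h2 h3 P hPπ hPθ
  have hPσθ := h1 P hPπ hPθ
  have hfΦ : _root_.bivEval (algebraMap k F) (algebraMap k F c) (Φ c) f = 0 := by
    rw [(hPπ.bivEval hPσθ f).eq_zero_iff, ← hσbiv, hf]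
    simp
  have hsc : s (Φ c) = h c := h2 (by rw [← hsbiv, hfΦ, map_zero])
  refine mem_decompositionSubgroup_of_forall_mem fun x hx => ?_
  obtain ⟨p, q, hq, rfl⟩ := P.exists_eq_div_of_mem halg hπt hf hgen hPπ hPθ h3 hx
  rw [map_div₀, hσbiv, hσbiv]
  refine ((hPπ.bivEval hPσθ p).div (hPπ.bivEval hPσθ q) fun h0 => hq ?_).mem
  rw [← hsc, ← hsbiv, h0, map_zero]

/-- A given place of the ground field does not lie below the nearby places. -/
lemma eventually_comap_ne [FiniteDimensional k F]
    (hnorm : ∀ y y' : F, minpoly k y = minpoly k y' → ‖y‖ = ‖y'‖)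
    {x : K} {Φ : k → F} (hΦ : Tendsto Φ (𝓝 0) (𝓝 0)) (hΦ0 : ∀ᶠ c in 𝓝[≠] 0, Φ c ≠ 0)
    (hval : ∀ᶠ c in 𝓝 0, ∀ P : FieldPlace k L F,
      P.Val π (algebraMap k F c) → P.Val θ (h c) → P.Val (algebraMap K L x) (Φ c))
    (w : ValuationSubring K) :
    ∀ᶠ c in 𝓝[≠] 0, ∀ P : FieldPlace k L F,
      P.Val π (algebraMap k F c) → P.Val θ (h c) → P.ring.comap (algebraMap K L) ≠ w := by
  by_cases H : ∃ (P : FieldPlace k L F) (y : F), P.ring.comap (algebraMap K L) = w ∧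
    P.Val (algebraMap K L x) y ∧ y ≠ 0
  · obtain ⟨P₁, y, hw, hy, hy0⟩ := H
    have hlim : Tendsto (fun c => ‖Φ c‖) (𝓝 0) (𝓝 0) := by simpa using hΦ.norm
    filter_upwards [nhdsWithin_le_nhds hval,
      nhdsWithin_le_nhds (hlim.eventually_ne (norm_ne_zero_iff.2 hy0).symm)] with c h1 h2 P hπ hθ hP
    refine h2 (hnorm _ _ ((h1 P hπ hθ).minpoly_eq hy (Algebra.IsIntegral.isIntegral _)
      fun q hq => ?_))
    rw [aeval_algebraMap_apply] at hq ⊢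
    rwa [valuation_lt_one_iff_of_comap_eq (hw.trans hP.symm)]
  · filter_upwards [nhdsWithin_le_nhds hval, hΦ0] with c h1 h2 P hπ hθ hP
    exact H ⟨P, _, hP, h1 P hπ hθ, h2⟩

end FieldPlace

namespace FieldPlace

/-- Near an unramified place there are infinitely many places with the same decomposition
group. -/
theorem exists_comap_notMem {k K L F : Type*} [NontriviallyNormedField k] [Field K] [Field L]
    [Algebra k K] [Algebra k L] [Algebra K L] [IsScalarTower k K L]
    [NontriviallyNormedField F] [NormedAlgebra k F] [CompleteSpace F] [FiniteDimensional k F]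
    [Finite (L ≃ₐ[K] L)] (P₀ : FieldPlace k L F) {f : k[X][X]} {π θ : L} {b : F}
    (hnorm : ∀ y y' : F, minpoly k y = minpoly k y' → ‖y‖ = ‖y'‖)
    (halg : ∀ a z : L, Transcendental k a →
      ∃ p : k[X][X], p ≠ 0 ∧ _root_.bivEval (algebraMap k L) a z p = 0)
    (hf : _root_.bivEval (algebraMap k L) π θ f = 0)
    (hker : ∀ p, _root_.bivEval (algebraMap k L) π θ p = 0 → f ∣ p)
    (hgen : ∀ x : L, ∃ p q : k[X][X], _root_.bivEval (algebraMap k L) π θ q ≠ 0 ∧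
      x = _root_.bivEval (algebraMap k L) π θ p / _root_.bivEval (algebraMap k L) π θ q)
    (hπ : P₀.Val π 0) (hπ0 : π ≠ 0) (hθ : P₀.Val θ b)
    (hf' : _root_.bivEval (algebraMap k F) 0 b (derivative f) ≠ 0)
    (hsurj : ∀ y : F, ∃ x, P₀.Val x y)
    (hfix : ∀ σ ∈ P₀.ring.decompositionSubgroup K, σ π = π)
    {x : K} (hx0 : x ≠ 0) (hx : P₀.ring.valuation (algebraMap K L x) < 1)
    {S : Set (ValuationSubring K)} (hS : S.Finite) :
    ∃ P : FieldPlace k L F, P.ring.comap (algebraMap K L) ∉ S ∧ P.ring ≠ ⊤ ∧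
      P.ring.decompositionSubgroup K = P₀.ring.decompositionSubgroup K := by
  have hπlt : P₀.ring.valuation π < 1 := hπ.eq_zero_iff.1 rfl
  have hπt : Transcendental k π := transcendental_of_valuation_lt_one P₀.algebraMap_mem hπlt hπ0
  have hf0 : _root_.bivEval (algebraMap k F) 0 b f = 0 := by
    rw [(hπ.bivEval hθ f).eq_zero_iff, hf]
    simp
  obtain ⟨h, hh, hhf, huniq⟩ := exists_implicit_bivEval hf0 hf'
  have hval := fun x y => exists_tendsto_val (x := x) (y := y) halg hπt hf hgen hπ hθ hf' hh
  obtain ⟨Φ, hΦ, hΦ'⟩ := hval _ _ (val_zero_of_lt hx)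
  have hx0' : algebraMap K L x ≠ 0 := by simpa using hx0
  obtain ⟨n, hn⟩ := exists_pow_le_valuation P₀.algebraMap_mem hπlt hx0' (halg _ _ hπt)
  obtain ⟨y, hy⟩ : ∃ y, P₀.Val (π ^ n / algebraMap K L x) y := by
    refine exists_val ?_
    rw [← P₀.ring.valuation_le_one_iff, map_div₀, map_pow]
    exact div_le_one_of_le₀ hn zero_le
  obtain ⟨Ψ, -, hΨ⟩ := hval _ _ hy
  have hplace : ∀ᶠ c in 𝓝 0,
      ∃ P : FieldPlace k L F, P.Val π (algebraMap k F c) ∧ P.Val θ (h c) := by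
    filter_upwards [hhf, (tendsto_bivEval hh (derivative f)).eventually_ne hf'] with c h1 h2
    exact exists_of_smooth_point halg hπt hf hker hgen (Algebra.IsIntegral.isIntegral _) h1 h2
  have hΦ0 : ∀ᶠ c in 𝓝[≠] 0, Φ c ≠ 0 := by
    filter_upwards [nhdsWithin_le_nhds hplace, nhdsWithin_le_nhds hΦ', nhdsWithin_le_nhds hΨ,
      self_mem_nhdsWithin] with c ⟨P, h1, h2⟩ h3 h4 h5 h0
    have h6 := (h3 P h1 h2).mul (h4 P h1 h2)
    rw [mul_div_cancel₀ _ hx0', h0, zero_mul] at h6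
    have h7 := h6.unique (h1.pow n)
    rw [eq_comm, ← map_pow, map_eq_zero] at h7
    exact h5 (eq_zero_of_pow_eq_zero h7)
  have hD : ∀ᶠ c in 𝓝 0, ∀ σ : L ≃ₐ[K] L, ∀ P : FieldPlace k L F,
      P.Val π (algebraMap k F c) → P.Val θ (h c) →
        (σ ∈ P.ring.decompositionSubgroup K ↔ σ ∈ P₀.ring.decompositionSubgroup K) := by
    rw [eventually_all]
    intro σ
    by_cases hσ : σ ∈ P₀.ring.decompositionSubgroup K
    · filter_upwards [eventually_mem_decompositionSubgroup hnorm halg hπt hf hgen hθ hf' hh huniq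
        hval hsurj hσ (hfix σ hσ)] with c hc P h1 h2
      exact iff_of_true (hc P h1 h2) hσ
    · filter_upwards [eventually_notMem_decompositionSubgroup hnorm hval hσ] with c hc P h1 h2
      exact iff_of_false (hc P h1 h2) hσ
  have hw := (eventually_all_finite hS).2 fun w _ => eventually_comap_ne hnorm hΦ hΦ0 hΦ' w
  obtain ⟨c, ⟨P, h1, h2⟩, h3, h4⟩ :=
    ((hplace.filter_mono nhdsWithin_le_nhds).and
      ((hD.filter_mono nhdsWithin_le_nhds).and hw)).exists
  refine ⟨P, fun hP => h4 _ hP P h1 h2 rfl, fun htop => ?_, Subgroup.ext fun σ => h3 σ P h1 h2⟩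
  have h5 := h1.sub (P.val_algebraMap c)
  rw [sub_self] at h5
  have h6 := h5.eq_zero_iff.1 rfl
  rw [valuation_lt_one_iff_inv_notMem, htop, sub_eq_zero] at h6
  rcases h6 with h6 | h6
  · exact hπt (h6 ▸ isAlgebraic_algebraMap c)
  · exact h6 (ValuationSubring.mem_top _)

end FieldPlace

end

namespace FieldPlace

variable {k K L : Type*} [NontriviallyNormedField k] [CompleteSpace k] [IsUltrametricDist k]
  [Field K] [Field L] [Algebra k K] [Algebra k L] [Algebra K L] [IsScalarTower k K L]
  [Finite (L ≃ₐ[K] L)]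

theorem exists_comap_notMem_of_finiteDimensional {F : Type*} [Field F] [Algebra k F]
    [FiniteDimensional k F]
    (P₀ : FieldPlace k L F) {f : k[X][X]} {π θ : L} {b : F}
    (halg : ∀ a z : L, Transcendental k a →
      ∃ p : k[X][X], p ≠ 0 ∧ _root_.bivEval (algebraMap k L) a z p = 0)
    (hf : _root_.bivEval (algebraMap k L) π θ f = 0)
    (hker : ∀ p, _root_.bivEval (algebraMap k L) π θ p = 0 → f ∣ p)
    (hgen : ∀ x : L, ∃ p q : k[X][X], _root_.bivEval (algebraMap k L) π θ q ≠ 0 ∧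
      x = _root_.bivEval (algebraMap k L) π θ p / _root_.bivEval (algebraMap k L) π θ q)
    (hπ : P₀.Val π 0) (hπ0 : π ≠ 0) (hθ : P₀.Val θ b)
    (hf' : _root_.bivEval (algebraMap k F) 0 b (derivative f) ≠ 0)
    (hsurj : ∀ y : F, ∃ x, P₀.Val x y)
    (hfix : ∀ σ ∈ P₀.ring.decompositionSubgroup K, σ π = π)
    {x : K} (hx0 : x ≠ 0) (hx : P₀.ring.valuation (algebraMap K L x) < 1)
    {S : Set (ValuationSubring K)} (hS : S.Finite) :
    ∃ P : FieldPlace k L F, P.ring.comap (algebraMap K L) ∉ S ∧ P.ring ≠ ⊤ ∧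
      P.ring.decompositionSubgroup K = P₀.ring.decompositionSubgroup K := by
  let := spectralNorm.nontriviallyNormedField k F
  let : NormedAlgebra k F := spectralNorm.normedAlgebra k F
  have : CompleteSpace F := spectralNorm.completeSpace k F
  refine P₀.exists_comap_notMem (fun y y' h => ?_) halg hf hker hgen hπ hπ0 hθ hf' hsurj hfix hx0
    hx hS
  change spectralNorm k F y = spectralNorm k F y'
  rw [spectralNorm, spectralNorm, h]

end FieldPlace

/-- A place with trivial inertia has infinitely many companions with the same decomposition
group. -/
theorem exists_valuationSubring_comap_notMem {k K L : Type*} [NontriviallyNormedField k]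
    [CompleteSpace k] [IsUltrametricDist k] [CharZero k]
    [Field K] [Field L] [Algebra k K] [Algebra k L] [Algebra K L] [IsScalarTower k K L]
    [Finite (L ≃ₐ[K] L)]
    (hfin : ∀ a : L, Transcendental k a → FiniteDimensional (IntermediateField.adjoin k {a}) L)
    {B : ValuationSubring L} (hk : ∀ c : k, algebraMap k L c ∈ B)
    (hB : B.comap (algebraMap K L) ≠ ⊤) (hunr : B.inertiaSubgroup K = ⊥)
    {S : Set (ValuationSubring K)} (hS : S.Finite) :
    ∃ W : ValuationSubring L, W.comap (algebraMap K L) ∉ S ∧ W ≠ ⊤ ∧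
      (∀ c : k, algebraMap k L c ∈ W) ∧
      W.decompositionSubgroup K = B.decompositionSubgroup K := by
  obtain ⟨z, hz⟩ : ∃ z, algebraMap K L z ∉ B := by
    by_contra! h
    exact hB (eq_top_iff.2 fun x _ => h x)
  have hz0 : z ≠ 0 := by
    rintro rfl
    exact hz (by rw [map_zero]; exact B.zero_mem)
  have hzlt : B.valuation (algebraMap K L z⁻¹) < 1 := by
    rw [valuation_lt_one_iff_inv_notMem, map_inv₀, inv_inv]
    exact Or.inr hz
  have hBtop : B ≠ ⊤ := by
    rintro rfl
    exact hz (ValuationSubring.mem_top _)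
  obtain ⟨ϖ, hϖ⟩ := exists_isUnif_of_finiteDimensional hfin hk hBtop
  obtain ⟨π, hπ, hfix⟩ := exists_isUnif_fixed hunr hϖ
  obtain ⟨θ, hθ, f, hf, hf', hker, hgen⟩ := exists_smooth_coordinate_of_finiteDimensional hfin hk hπ
  have halg := exists_bivEval_eq_zero hfin
  let F := IsLocalRing.ResidueField B
  let : Algebra k F :=
    ((IsLocalRing.residue B).comp ((algebraMap k L).codRestrict B hk)).toAlgebra
  let P₀ : FieldPlace k L F := ⟨B, hk, IsLocalRing.residue B, fun _ => rfl, fun x =>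
    residue_eq_zero_iff_valuation x⟩
  have hPπ : P₀.Val π 0 := FieldPlace.val_zero_of_lt hπ.2.1
  obtain ⟨b, hPθ⟩ : ∃ b, P₀.Val θ b := FieldPlace.exists_val hθ
  have hfb : bivEval (algebraMap k F) 0 b f = 0 := by
    rw [(hPπ.bivEval hPθ f).eq_zero_iff, hf]
    simp
  have hfb' : bivEval (algebraMap k F) 0 b (derivative f) ≠ 0 :=
    (hPπ.bivEval hPθ _).ne_zero_of_valuation hf'
  have hπt := transcendental_of_valuation_lt_one hk hπ.2.1 hπ.1
  have hmap : ∀ p : k[X][X], bivEval (algebraMap k F) 0 b p = aeval b (p.map (evalRingHom 0)) := by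
    intro p
    rw [aeval_def, eval₂_map_evalRingHom, map_zero]
  have hb : IsIntegral k b := by
    refine isAlgebraic_iff_isIntegral.1 ⟨f.map (evalRingHom 0), fun h0 => hfb' ?_, ?_⟩
    · rw [hmap, ← derivative_map, h0, derivative_zero, map_zero]
    · rw [← hmap, hfb]
  have hmem : ∀ p, bivEval (algebraMap k F) 0 b p ∈ IntermediateField.adjoin k {b} := by
    intro p
    rw [hmap]
    exact IntermediateField.algebra_adjoin_le_adjoin k _ (aeval_mem_adjoin_singleton k b)
  have hsurj : ∀ y : F, ∃ x, P₀.Val x y := fun y => by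
    obtain ⟨⟨x, hx⟩, rfl⟩ := IsLocalRing.residue_surjective y
    exact ⟨x, hx, rfl⟩
  have htop : IntermediateField.adjoin k {b} = ⊤ := by
    refine eq_top_iff.2 fun y _ => ?_
    obtain ⟨x, hx⟩ := hsurj y
    obtain ⟨p, q, hq, rfl⟩ := P₀.exists_eq_div_of_mem (c := 0) halg hπt hf hgen
      (by rwa [map_zero]) hPθ (by rwa [map_zero]) hx.mem
    rw [map_zero] at hq
    rw [hx.unique ((hPπ.bivEval hPθ p).div (hPπ.bivEval hPθ q) hq)]
    exact div_mem (hmem p) (hmem q)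
  have : FiniteDimensional k F := by
    have := IntermediateField.adjoin.finiteDimensional hb
    rw [htop] at this
    exact IntermediateField.topEquiv.toLinearEquiv.finiteDimensional
  obtain ⟨P, h1, h2, h3⟩ := P₀.exists_comap_notMem_of_finiteDimensional (K := K) halg hf hker hgen
    hPπ hπ.1 hPθ hfb' hsurj hfix (inv_ne_zero hz0) hzlt hS
  exact ⟨P.ring, h1, h2, P.algebraMap_mem, h3⟩

/-- A function field in one variable is finite over the subfield generated by any nonconstant
function. -/
lemma finiteDimensional_adjoin_simple_of_ratFunc {k L : Type*} [Field k] [Field L] [Algebra k L]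
    [Algebra (RatFunc k) L] [IsScalarTower k (RatFunc k) L] [FiniteDimensional (RatFunc k) L]
    {a : L} (ha : Transcendental k a) :
    FiniteDimensional (IntermediateField.adjoin k {a}) L := by
  let : Algebra k[X] L := ((algebraMap (RatFunc k) L).comp (algebraMap k[X] (RatFunc k))).toAlgebra
  have : IsScalarTower k[X] (RatFunc k) L := .of_algebraMap_eq fun _ => rfl
  have : IsScalarTower k k[X] L := .of_algebraMap_eq fun x => by
    rw [IsScalarTower.algebraMap_apply k[X] (RatFunc k) L, ← IsScalarTower.algebraMap_apply k k[X],
      ← IsScalarTower.algebraMap_apply]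
  have : FaithfulSMul k[X] L := by
    rw [faithfulSMul_iff_algebraMap_injective]
    exact (algebraMap (RatFunc k) L).injective.comp (IsFractionRing.injective k[X] (RatFunc k))
  have : Algebra.IsAlgebraic k[X] L :=
    (IsFractionRing.comap_isAlgebraic_iff (A := k[X]) (K := RatFunc k)).2 inferInstance
  have htr := lift_trdeg_add_eq k k[X] L
  rw [Polynomial.trdeg_of_isDomain, trdeg_eq_zero, Cardinal.lift_zero, add_zero, Cardinal.lift_one,
    eq_comm, Cardinal.lift_eq_one] at htr
  have hind : AlgebraicIndependent k (fun _ : Unit => a) :=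
    algebraicIndependent_unique_type_iff.2 ha
  have hbas := hind.isTranscendenceBasis_of_lift_trdeg_le_of_finite (by simp [htr])
  have halg := hbas.isAlgebraic_field
  rw [Set.range_const] at halg
  have : Algebra.EssFiniteType k[X] (RatFunc k) :=
    Algebra.EssFiniteType.of_isLocalization _ (nonZeroDivisors k[X])
  have : Algebra.EssFiniteType k[X] L := Algebra.EssFiniteType.comp k[X] (RatFunc k) L
  have : Algebra.EssFiniteType k L := Algebra.EssFiniteType.comp k k[X] L
  have : Algebra.EssFiniteType (IntermediateField.adjoin k {a}) L :=
    Algebra.EssFiniteType.of_comp k _ L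
  obtain ⟨s, hs⟩ := IntermediateField.fg_top (IntermediateField.adjoin k {a}) L
  have := IntermediateField.finiteDimensional_adjoin (K := IntermediateField.adjoin k {a})
    (S := (s : Set L)) fun x _ => Algebra.IsIntegral.isIntegral x
  rw [hs] at this
  exact IntermediateField.topEquiv.toLinearEquiv.finiteDimensional

open scoped WithZero in
theorem exists_valuationSubring_comap_notMem_of_ratFunc {k K L : Type*} [Field k] [Valued k ℤᵐ⁰]
    [(Valued.v : Valuation k ℤᵐ⁰).IsRankOneDiscrete] [CompleteSpace k] [CharZero k]
    [Field K] [Field L] [Algebra k K] [Algebra (RatFunc k) K] [IsScalarTower k (RatFunc k) K]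
    [FiniteDimensional (RatFunc k) K] [Algebra K L] [FiniteDimensional K L]
    {B : ValuationSubring L} (hk : ∀ c : k, algebraMap k K c ∈ B.comap (algebraMap K L))
    (hB : B.comap (algebraMap K L) ≠ ⊤) (hunr : B.inertiaSubgroup K = ⊥)
    {S : Set (ValuationSubring K)} (hS : S.Finite) :
    ∃ W : ValuationSubring L, W.comap (algebraMap K L) ∉ S ∧ W.comap (algebraMap K L) ≠ ⊤ ∧
      (∀ c : k, algebraMap k K c ∈ W.comap (algebraMap K L)) ∧
      W.decompositionSubgroup K = B.decompositionSubgroup K := by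
  let : Algebra k L := ((algebraMap K L).comp (algebraMap k K)).toAlgebra
  let : Algebra (RatFunc k) L := ((algebraMap K L).comp (algebraMap (RatFunc k) K)).toAlgebra
  have : IsScalarTower k K L := .of_algebraMap_eq fun _ => rfl
  have : IsScalarTower (RatFunc k) K L := .of_algebraMap_eq fun _ => rfl
  have : IsScalarTower k (RatFunc k) L := .of_algebraMap_eq fun x => by
    rw [IsScalarTower.algebraMap_apply k K L, IsScalarTower.algebraMap_apply (RatFunc k) K L,
      ← IsScalarTower.algebraMap_apply k (RatFunc k) K]
  have : FiniteDimensional (RatFunc k) L := FiniteDimensional.trans (RatFunc k) K L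
  have hfin := fun a : L => finiteDimensional_adjoin_simple_of_ratFunc (k := k) (a := a)
  let := Valuation.IsRankOneDiscrete.rankOne (Valued.v : Valuation k ℤᵐ⁰) (e := 2) one_lt_two
  let : NontriviallyNormedField k := Valued.toNontriviallyNormedField k ℤᵐ⁰
  have : IsUltrametricDist k := Valued.instIsUltrametricDist k ℤᵐ⁰
  obtain ⟨W, h1, h2, h3, h4⟩ := exists_valuationSubring_comap_notMem hfin hk hB hunr hS
  refine ⟨W, h1, fun htop => h2 (eq_top_iff.2 fun x _ => ?_), h3, h4⟩
  have hK : ∀ c : K, algebraMap K L c ∈ W := fun c => (SetLike.ext_iff.1 htop c).2 trivial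
  exact mem_of_isIntegral_of_mem hK (Algebra.IsIntegral.isIntegral x)

lemma isRankOneDiscrete_laurentSeries (F : Type*) [Field F] :
    (Valued.v : Valuation (LaurentSeries F) (WithZero (Multiplicative ℤ))).IsRankOneDiscrete :=
  Valuation.IsRankOneDiscrete.mk' ((PowerSeries.idealX F).valuation (LaurentSeries F))

end

/-- Let `K` be the function field of a smooth projective curve over `ℂ((t))`
(equivalently, a finite extension of the rational function field `ℂ((t))(u)`), let `L/K`
be a finite Galois extension with group `G = Gal(L/K)`, and let `v` be a place of `K`
(a valuation subring `≠ K` containing the image of `ℂ((t))`) that is unramified in `L/K`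
(the inertia subgroup of every extension of `v` to `L` is trivial). Fix an extension `Bv`
of `v` to `L`. Then the set of places `w` of `K` admitting an extension `Bw` to `L` whose
decomposition group is conjugate in `G` to that of `Bv` is infinite. -/
theorem stmt_0 (K L : Type) [Field K] [Field L]
    [Algebra (LaurentSeries ℂ) K]
    [Algebra (RatFunc (LaurentSeries ℂ)) K]
    [IsScalarTower (LaurentSeries ℂ) (RatFunc (LaurentSeries ℂ)) K]
    [FiniteDimensional (RatFunc (LaurentSeries ℂ)) K]
    [Algebra K L] [IsGalois K L] [FiniteDimensional K L]
    (v : ValuationSubring K) (hv1 : v ≠ ⊤)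
    (hv2 : ∀ a : LaurentSeries ℂ, algebraMap (LaurentSeries ℂ) K a ∈ v)
    (hunr : ∀ B : ValuationSubring L, B.comap (algebraMap K L) = v →
      B.inertiaSubgroup K = ⊥)
    (Bv : ValuationSubring L) (hBv : Bv.comap (algebraMap K L) = v) :
    {w : ValuationSubring K | w ≠ ⊤ ∧
      (∀ a : LaurentSeries ℂ, algebraMap (LaurentSeries ℂ) K a ∈ w) ∧
      ∃ Bw : ValuationSubring L, Bw.comap (algebraMap K L) = w ∧
        ∃ σ : L ≃ₐ[K] L,
          MulAut.conj σ • Bw.decompositionSubgroup K = Bv.decompositionSubgroup K}.Infinite := by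
  intro hS
  have := isRankOneDiscrete_laurentSeries ℂ
  have : CharZero (LaurentSeries ℂ) :=
    charZero_of_injective_algebraMap (algebraMap ℂ (LaurentSeries ℂ)).injective
  subst hBv
  obtain ⟨W, h1, h2, h3, h4⟩ :=
    exists_valuationSubring_comap_notMem_of_ratFunc hv2 hv1 (hunr _ rfl) hS
  exact h1 ⟨h2, h3, W, rfl, 1, by rw [map_one, one_smul, h4]⟩
end

section
/- Let K be the function field of a smooth projective curve over ℂ((t)) and let L/K be a finite Galois extension. Then there exists a place v of K that is totally split in L/K, i.e. such that the decomposition group of every extension of v to L is trivial. -/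
open Polynomial Filter Topology
open scoped Pointwise

theorem hasStrictFDerivAt_evalEval {F : Type*} [NontriviallyNormedField F] (P : F[X][X])
    (z : F × F) : ∃ f' : F × F →L[F] F,
      HasStrictFDerivAt (fun w : F × F => P.evalEval w.1 w.2) f' z ∧
      ∀ y, f' (0, y) = P.derivative.evalEval z.1 z.2 * y := by
  induction P using Polynomial.induction_on' with
  | add p q hp hq =>
    obtain ⟨f, hf, hf'⟩ := hp
    obtain ⟨g, hg, hg'⟩ := hq
    refine ⟨f + g, ?_, fun y => ?_⟩
    · simpa [evalEval_add] using! hf.add hg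
    · simp [hf', hg', evalEval_add, add_mul]
  | monomial n a =>
    have h1 : HasStrictFDerivAt (fun w : F × F => a.eval w.1) _ z :=
      (a.hasStrictDerivAt z.1).hasStrictFDerivAt.comp z (hasStrictFDerivAt_fst)
    have h2 : HasStrictFDerivAt (fun w : F × F => w.2 ^ n) _ z :=
      (hasStrictDerivAt_pow n z.2).hasStrictFDerivAt.comp z (hasStrictFDerivAt_snd)
    have h3 : (fun w : F × F => (monomial n a).evalEval w.1 w.2) =
        fun w => a.eval w.1 * w.2 ^ n := by
      ext w
      simp [evalEval, eval_monomial]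
    rw [h3]
    refine ⟨_, h1.mul h2, fun y => ?_⟩
    simp [evalEval, derivative_monomial, eval_monomial]
    ring

theorem eventually_exists_evalEval_eq_zero {F : Type*} [NontriviallyNormedField F]
    [CompleteSpace F] (P : F[X][X]) (u θ : F) (h0 : P.evalEval u θ = 0)
    (h1 : P.derivative.evalEval u θ ≠ 0) : ∀ᶠ x in 𝓝 u, ∃ y, P.evalEval x y = 0 := by
  obtain ⟨f', hf, hf'⟩ := hasStrictFDerivAt_evalEval P (u, θ)
  have hinv : (f' ∘L .inr F F F).IsInvertible := by
    refine ⟨ContinuousLinearEquiv.unitsEquivAut F (Units.mk0 _ h1), ?_⟩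
    ext
    simp [hf']
  filter_upwards [hf.eventually_apply_implicitFunctionOfProdDomain hinv] with x hx
  exact ⟨_, hx.trans h0⟩

/-- A nonsingular point of `P = 0` over an `F`-rational point `u` of the line can be moved to a
point whose first coordinate generates the residue extension `E / F`. -/
theorem exists_root_generating {F : Type*} [NontriviallyNormedField F] [CompleteSpace F]
    [IsUltrametricDist F] [CharZero F] {E : Type*} [Field E] [Algebra F E] [FiniteDimensional F E]
    (P : F[X][X]) (d : F[X]) (u : F) (θ : E) (hd : d.eval u ≠ 0)
    (h0 : P.eval₂ (aeval (algebraMap F E u)).toRingHom θ = 0)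
    (h1 : P.derivative.eval₂ (aeval (algebraMap F E u)).toRingHom θ ≠ 0) :
    ∃ x y : E, P.eval₂ (aeval x).toRingHom y = 0 ∧ aeval x d ≠ 0 ∧
      Algebra.adjoin F {x} = ⊤ := by
  let := spectralNorm.nontriviallyNormedField F E
  let : NormedAlgebra F E := spectralNorm.normedAlgebra F E
  have : CompleteSpace E := spectralNorm.completeSpace F E
  obtain ⟨α, hα⟩ := Field.exists_primitive_element F E
  have hev : ∀ (Q : F[X][X]) (x y : E), (Q.map (mapRingHom (algebraMap F E))).evalEval x y =
      Q.eval₂ (aeval x).toRingHom y := by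
    intro Q x y
    rw [evalEval, eval_map, ← coe_evalRingHom, hom_eval₂]
    simp only [coe_evalRingHom, eval_C]
    congr 1
    ext <;> simp
  have hz : ∀ᶠ x in 𝓝 (algebraMap F E u), ∃ y,
      (P.map (mapRingHom (algebraMap F E))).evalEval x y = 0 :=
    eventually_exists_evalEval_eq_zero _ _ θ (by rw [hev, h0]) (by
      rw [derivative_map, hev]; exact h1)
  have hd' : ∀ᶠ x in 𝓝 (algebraMap F E u), aeval x d ≠ 0 :=
    (d.continuous_aeval.continuousAt).eventually_ne (by
      rw [aeval_algebraMap_apply]; simpa using hd)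
  have ht : Tendsto (fun ε : F => algebraMap F E u + algebraMap F E ε * α) (𝓝 0)
      (𝓝 (algebraMap F E u)) := by
    have : Continuous (fun ε : F => algebraMap F E u + algebraMap F E ε * α) :=
      continuous_const.add ((continuous_algebraMap F E).mul continuous_const)
    simpa using this.tendsto 0
  obtain ⟨ε, ⟨⟨y, hy⟩, hεd⟩, hε⟩ :=
    (((ht.eventually (hz.and hd')).filter_mono nhdsWithin_le_nhds).and
      (self_mem_nhdsWithin : ({0}ᶜ : Set F) ∈ 𝓝[≠] 0)).exists
  refine ⟨_, y, by rw [← hev, hy], hεd, ?_⟩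
  have hα' : Algebra.adjoin F {α} = ⊤ := by
    rw [← IntermediateField.adjoin_simple_toSubalgebra_of_isAlgebraic
      (Algebra.IsAlgebraic.isAlgebraic α), hα, IntermediateField.top_toSubalgebra]
  rw [eq_top_iff, ← hα', Algebra.adjoin_le_iff, Set.singleton_subset_iff]
  set x := algebraMap F E u + algebraMap F E ε * α with hx
  have : α = ε⁻¹ • (x - algebraMap F E u) := by
    rw [hx, add_sub_cancel_left, ← Algebra.smul_def, inv_smul_smul₀ hε]
  rw [this]
  exact Subalgebra.smul_mem _ (sub_mem (Algebra.self_mem_adjoin_singleton F x)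
    (Subalgebra.algebraMap_mem _ _)) _

open scoped Valued in
theorem LaurentSeries.exists_root_generating {k : Type*} [Field k] [CharZero (LaurentSeries k)]
    {E : Type*} [Field E] [Algebra (LaurentSeries k) E] [FiniteDimensional (LaurentSeries k) E]
    (P : (LaurentSeries k)[X][X]) (d : (LaurentSeries k)[X]) (u : LaurentSeries k) (θ : E)
    (hd : d.eval u ≠ 0)
    (h0 : P.eval₂ (aeval (algebraMap (LaurentSeries k) E u)).toRingHom θ = 0)
    (h1 : P.derivative.eval₂ (aeval (algebraMap (LaurentSeries k) E u)).toRingHom θ ≠ 0) :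
    ∃ x y : E, P.eval₂ (aeval x).toRingHom y = 0 ∧ aeval x d ≠ 0 ∧
      Algebra.adjoin (LaurentSeries k) {x} = ⊤ := by
  have hX : Valued.v (HahnSeries.single 1 1 : LaurentSeries k) = WithZero.exp (-1 : ℤ) := by
    simpa using LaurentSeries.valuation_single_zpow k 1
  let : (Valued.v (R := LaurentSeries k) (Γ₀ := WithZero (Multiplicative ℤ))).RankOne :=
    have : ((PowerSeries.idealX k).valuation (LaurentSeries k)).IsRankOneDiscrete :=
      Valuation.IsRankOneDiscrete.mk' _
    Valuation.IsRankOneDiscrete.rankOne ((PowerSeries.idealX k).valuation (LaurentSeries k))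
      (e := 2) (by norm_num)
  let : NontriviallyNormedField (LaurentSeries k) :=
    { Valued.toNormedField (LaurentSeries k) (WithZero (Multiplicative ℤ)) with
      non_trivial := by
        refine ⟨(HahnSeries.single 1 1)⁻¹, ?_⟩
        rw [Valued.toNormedField.one_lt_norm_iff, map_inv₀, hX]
        decide }
  exact _root_.exists_root_generating P d u θ hd h0 h1


/-- A finite extension of `F(X)` has a primitive element which is integral over `F[X]`. -/
theorem exists_monic_generator (F : Type*) [Field F] [CharZero F] (L : Type*) [Field L]
    [Algebra (RatFunc F) L] [FiniteDimensional (RatFunc F) L] :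
    ∃ (θ : L) (P : F[X][X]), IntermediateField.adjoin (RatFunc F) {θ} = ⊤ ∧ P.Monic ∧
      minpoly (RatFunc F) θ = P.map (algebraMap F[X] (RatFunc F)) := by
  let : Algebra F[X] L := ((algebraMap (RatFunc F) L).comp (algebraMap F[X] (RatFunc F))).toAlgebra
  have : IsScalarTower F[X] (RatFunc F) L := IsScalarTower.of_algebraMap_eq fun _ => rfl
  obtain ⟨α, hα⟩ := Field.exists_primitive_element (RatFunc F) L
  have halg : IsAlgebraic F[X] α :=
    (IsFractionRing.isAlgebraic_iff F[X] (RatFunc F) L).2 (Algebra.IsAlgebraic.isAlgebraic α)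
  obtain ⟨y, hy, hyα⟩ := halg.exists_integral_multiple
  refine ⟨y • α, minpoly F[X] (y • α), ?_, minpoly.monic hyα,
    minpoly.isIntegrallyClosed_eq_field_fractions' (RatFunc F) hyα⟩
  rw [eq_top_iff, ← hα, IntermediateField.adjoin_simple_le_iff]
  have hy' : algebraMap F[X] (RatFunc F) y ≠ 0 := by simpa using hy
  have hmem := (IntermediateField.adjoin (RatFunc F) {y • α}).smul_mem
    (IntermediateField.mem_adjoin_simple_self (RatFunc F) (y • α))
    (x := (algebraMap F[X] (RatFunc F) y)⁻¹)
  rwa [show (algebraMap F[X] (RatFunc F) y)⁻¹ • (y • α) = α by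
    rw [← algebraMap_smul (RatFunc F) y α, inv_smul_smul₀ hy']] at hmem

theorem exists_bezout_of_separable {R K : Type*} [CommRing R] [IsDomain R] [Field K]
    [Algebra R K] [IsFractionRing R K] (P : R[X]) (hP : (P.map (algebraMap R K)).Separable) :
    ∃ (d : R) (a b : R[X]), d ≠ 0 ∧ a * P + b * derivative P = C d := by
  obtain ⟨a, b, hab⟩ := hP
  obtain ⟨c, hc, hca⟩ := IsLocalization.integerNormalization_spec (nonZeroDivisors R) a
  obtain ⟨e, he, heb⟩ := IsLocalization.integerNormalization_spec (nonZeroDivisors R) b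
  refine ⟨c * e, C e * IsLocalization.integerNormalization (nonZeroDivisors R) a,
    C c * IsLocalization.integerNormalization (nonZeroDivisors R) b,
    mul_ne_zero (nonZeroDivisors.ne_zero hc) (nonZeroDivisors.ne_zero he), ?_⟩
  apply Polynomial.map_injective (algebraMap R K) (IsFractionRing.injective R K)
  simp only [Polynomial.map_add, Polynomial.map_mul, hca, heb, map_C, map_mul,
    Algebra.smul_def, Polynomial.algebraMap_apply]
  rw [derivative_map] at hab
  linear_combination (C (algebraMap R K c) * C (algebraMap R K e)) * hab

/-- The substitution `X ↦ x + X`, from polynomials over `F` to power series over `E`. -/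
noncomputable def shiftHom (F : Type*) {E : Type*} [Field F] [Field E] [Algebra F E] (x : E) :
    F[X] →+* PowerSeries E :=
  (Polynomial.coeToPowerSeries.ringHom).comp
    ((taylorAlgHom x).toRingHom.comp (mapRingHom (algebraMap F E)))

section
variable {F E : Type*} [Field F] [Field E] [Algebra F E] (x : E)

theorem shiftHom_injective : Function.Injective (shiftHom F x) := by
  refine (Polynomial.coe_injective E).comp ((taylor_injective x).comp
    (Polynomial.map_injective _ (algebraMap F E).injective))

theorem coeff_shiftHom (f : F[X]) (n : ℕ) :
    PowerSeries.coeff n (shiftHom F x f) = (taylor x (f.map (algebraMap F E))).coeff n := by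
  simp [shiftHom]

theorem constantCoeff_shiftHom (f : F[X]) :
    PowerSeries.constantCoeff (shiftHom F x f) = aeval x f := by
  rw [← PowerSeries.coeff_zero_eq_constantCoeff_apply, coeff_shiftHom, taylor_coeff_zero,
    eval_map_algebraMap]

theorem coeff_one_shiftHom (f : F[X]) :
    PowerSeries.coeff 1 (shiftHom F x f) = aeval x (derivative f) := by
  rw [coeff_shiftHom, taylor_coeff_one, derivative_map, eval_map_algebraMap]

theorem shiftHom_C (a : F) : shiftHom F x (C a) = PowerSeries.C (algebraMap F E a) := by
  simp [shiftHom]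

theorem exists_eval₂_shiftHom_eq_zero (P : F[X][X]) (hP : P.Monic) (y : E)
    (h0 : P.eval₂ (aeval x).toRingHom y = 0)
    (h1 : P.derivative.eval₂ (aeval x).toRingHom y ≠ 0) :
    ∃ Θ : PowerSeries E, P.eval₂ (shiftHom F x) Θ = 0 := by
  have hev : ∀ Q : F[X][X], PowerSeries.constantCoeff
      ((Q.map (shiftHom F x)).eval (PowerSeries.C y)) = Q.eval₂ (aeval x).toRingHom y := by
    intro Q
    rw [eval_map, hom_eval₂, PowerSeries.constantCoeff_C]
    congr 1
    ext f
    · simp [constantCoeff_shiftHom]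
    · simp [constantCoeff_shiftHom]
  obtain ⟨Θ, hΘ, -⟩ := HenselianRing.is_henselian
    (I := Ideal.span {(PowerSeries.X : PowerSeries E)})
    (P.map (shiftHom F x)) (hP.map _) (PowerSeries.C y)
    (by rw [Ideal.mem_span_singleton, PowerSeries.X_dvd_iff, hev, h0])
    (by
      refine IsUnit.map _ ?_
      rw [PowerSeries.isUnit_iff_constantCoeff, derivative_map, hev]
      exact isUnit_iff_ne_zero.2 h1)
  exact ⟨Θ, by rwa [IsRoot, eval_map] at hΘ⟩

/-- A power series root of the minimal polynomial of a generator `θ` of `L / F(X)` extends the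
substitution `X ↦ x + X` to an embedding of `L` into Laurent series. -/
theorem exists_ringHom_laurentSeries {L : Type*} [Field L] [Algebra (RatFunc F) L]
    [FiniteDimensional (RatFunc F) L] (θ : L)
    (hθ : IntermediateField.adjoin (RatFunc F) {θ} = ⊤) (P : F[X][X])
    (hmin : minpoly (RatFunc F) θ = P.map (algebraMap F[X] (RatFunc F)))
    (Θ : PowerSeries E) (hΘ : P.eval₂ (shiftHom F x) Θ = 0) :
    ∃ φ : L →+* LaurentSeries E, ∀ f : F[X],
      φ (algebraMap (RatFunc F) L (algebraMap F[X] (RatFunc F) f)) =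
        HahnSeries.ofPowerSeries ℤ E (shiftHom F x f) := by
  let j : F[X] →+* LaurentSeries E := (HahnSeries.ofPowerSeries ℤ E).comp (shiftHom F x)
  have hj : Function.Injective j :=
    HahnSeries.ofPowerSeries_injective.comp (shiftHom_injective x)
  let i : RatFunc F →+* LaurentSeries E := IsFractionRing.lift hj
  have hi : ∀ f, i (algebraMap F[X] (RatFunc F) f) = j f := IsFractionRing.lift_algebraMap hj
  let : Algebra (RatFunc F) (LaurentSeries E) := i.toAlgebra
  have hint : IsIntegral (RatFunc F) θ := IsIntegral.of_finite _ _
  have hroot : (HahnSeries.ofPowerSeries ℤ E Θ) ∈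
      (minpoly (RatFunc F) θ).aroots (LaurentSeries E) := by
    rw [mem_aroots]
    refine ⟨minpoly.ne_zero hint, ?_⟩
    have : (algebraMap (RatFunc F) (LaurentSeries E)).comp (algebraMap F[X] (RatFunc F)) = j :=
      RingHom.ext hi
    rw [hmin, aeval_def, eval₂_map, this, ← hom_eval₂, hΘ, map_zero]
  let ψ := (IntermediateField.algHomAdjoinIntegralEquiv (RatFunc F) hint).symm ⟨_, hroot⟩
  let e : L →ₐ[RatFunc F] IntermediateField.adjoin (RatFunc F) {θ} :=
    ((IntermediateField.equivOfEq hθ).trans IntermediateField.topEquiv).symm.toAlgHom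
  refine ⟨(ψ.comp e).toRingHom, fun f => ?_⟩
  exact ((ψ.comp e).commutes _).trans (hi f)
end


theorem exists_prod_X_sub_C_eq_add {R ι : Type*} [CommRing R] (s : Finset ι) (f g : ι → R)
    (c : R) (h : ∀ i ∈ s, c ∣ g i - f i) :
    ∃ q : R[X], ∏ i ∈ s, (X - C (f i)) = ∏ i ∈ s, (X - C (g i)) + C c * q := by
  classical
  induction s using Finset.induction_on with
  | empty => exact ⟨0, by simp⟩
  | insert a s ha ih =>
    obtain ⟨q, hq⟩ := ih fun i hi => h i (Finset.mem_insert_of_mem hi)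
    obtain ⟨d, hd⟩ := h a (Finset.mem_insert_self a s)
    refine ⟨C d * (∏ i ∈ s, (X - C (g i))) + (X - C (f a)) * q, ?_⟩
    have hd' : C (g a) - C (f a) = C c * C d := by rw [← C_sub, hd, C_mul]
    rw [Finset.prod_insert ha, Finset.prod_insert ha, hq]
    linear_combination (∏ i ∈ s, (X - C (g i))) * hd'

section

variable {K L : Type*} [Field K] [Field L] [Algebra K L]

theorem coeff_prod_X_sub_C_mem_range [IsGalois K L] [FiniteDimensional K L] (y : L) (n : ℕ) :
    ∃ k : K, algebraMap K L k = (∏ σ : L ≃ₐ[K] L, (X - C (σ y))).coeff n := by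
  have h : ∀ τ : L ≃ₐ[K] L, τ ((∏ σ : L ≃ₐ[K] L, (X - C (σ y))).coeff n) =
      (∏ σ : L ≃ₐ[K] L, (X - C (σ y))).coeff n := by
    intro τ
    have : (∏ σ : L ≃ₐ[K] L, (X - C (σ y))).map (τ : L →+* L) =
        ∏ σ : L ≃ₐ[K] L, (X - C (σ y)) := by
      rw [Polynomial.map_prod]
      refine Fintype.prod_equiv (Equiv.mulLeft τ) _ _ fun σ => by simp
    conv_rhs => rw [← this]
    rw [coeff_map]; rfl
  obtain ⟨k, hk⟩ := (IsGalois.mem_range_algebraMap_iff_fixed (F := K) _).2 h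
  exact ⟨k, hk⟩

theorem ValuationSubring.coeff_prod_X_sub_C_mem (A : ValuationSubring L) {ι : Type*}
    (s : Finset ι) (f : ι → L) (hf : ∀ i ∈ s, f i ∈ A) (n : ℕ) :
    (∏ i ∈ s, (X - C (f i))).coeff n ∈ A := by
  have : (∏ i ∈ s, (X - C (f i))) ∈ Polynomial.lifts A.subtype :=
    prod_mem fun i hi => (mem_lifts _).2 ⟨X - C ⟨f i, hf i hi⟩, by simp⟩
  obtain ⟨a, ha⟩ := (lifts_iff_coeff_lifts _).1 this n
  rw [← ha]; exact a.2

theorem ValuationSubring.exists_prod_X_sub_C_eq_add (A : ValuationSubring L) {ι : Type*}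
    (s : Finset ι) (f g : ι → L) (c : L) (hc : c ∈ A) (hf : ∀ i, f i ∈ A) (hg : ∀ i, g i ∈ A)
    (h : ∀ i, ∃ d ∈ A, g i - f i = c * d) :
    ∃ q : L[X], (∀ n, q.coeff n ∈ A) ∧
      ∏ i ∈ s, (X - C (f i)) = ∏ i ∈ s, (X - C (g i)) + C c * q := by
  obtain ⟨q, hq⟩ := _root_.exists_prod_X_sub_C_eq_add (R := A) s (fun i => ⟨f i, hf i⟩)
    (fun i => ⟨g i, hg i⟩) ⟨c, hc⟩ (fun i _ => by
      obtain ⟨d, hd, hd'⟩ := h i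
      exact ⟨⟨d, hd⟩, Subtype.ext hd'⟩)
  refine ⟨q.map A.subtype, fun n => ?_, ?_⟩
  · rw [coeff_map]
    exact (q.coeff n).2
  · have hq' := congrArg (Polynomial.map A.subtype) hq
    simpa [Polynomial.map_prod] using hq'

theorem ValuationSubring.mem_of_monic (A : ValuationSubring L) (p : L[X]) (hp : p.Monic)
    (hc : ∀ n, p.coeff n ∈ A) (y : L) (hy : p.eval y = 0) : y ∈ A := by
  have hi : IsIntegral A y := by
    have hl : (↑p.coeffs : Set L) ⊆ A.toSubring := by
      intro c hc'
      obtain ⟨n, -, rfl⟩ := mem_coeffs_iff.1 hc'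
      exact hc n
    refine ⟨p.toSubring A.toSubring hl, (monic_toSubring _ _ _).2 hp, ?_⟩
    rw [← hy, ← eval_map]
    congr 1
    exact map_toSubring p A.toSubring hl
  obtain ⟨a, ha⟩ := IsIntegrallyClosed.isIntegral_iff.1 hi
  rw [← ha]; exact a.2

theorem ValuationSubring.mem_of_forall_conj_mem [IsGalois K L] [FiniteDimensional K L]
    {A B : ValuationSubring L} (hAB : A.comap (algebraMap K L) ≤ B.comap (algebraMap K L))
    (y : L) (hy : ∀ σ : L ≃ₐ[K] L, σ y ∈ A) : y ∈ B := by
  refine B.mem_of_monic (∏ σ : L ≃ₐ[K] L, (X - C (σ y)))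
    (monic_prod_of_monic _ _ fun _ _ => monic_X_sub_C _) (fun n => ?_) y ?_
  · obtain ⟨k, hk⟩ := coeff_prod_X_sub_C_mem_range (K := K) y n
    have : algebraMap K L k ∈ A := by
      rw [hk]
      exact A.coeff_prod_X_sub_C_mem _ _ (fun σ _ => hy σ) n
    rw [← hk]
    exact hAB this
  · rw [eval_prod]
    exact Finset.prod_eq_zero (Finset.mem_univ 1) (by simp)

theorem ValuationSubring.exists_mem_of_valuation_prod_lt_one (B : ValuationSubring L) {ι : Type*}
    (s : Finset ι) (y : ι → L) (h : B.valuation (∏ i ∈ s, y i) < 1) : ∃ i ∈ s, y i ∈ B := by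
  by_contra! H
  refine h.not_ge ?_
  rw [map_prod]
  refine Finset.one_le_prod' fun i hi => ?_
  by_contra! hlt
  exact H i hi ((B.valuation_le_one_iff _).1 hlt.le)

theorem ValuationSubring.exists_sub_div_pow_mem (A : ValuationSubring L) (π : K)
    (hπ0 : π ≠ 0)
    (hres : ∀ b ∈ A, ∃ f : K, (b - algebraMap K L f) / algebraMap K L π ∈ A)
    (b : L) (hb : b ∈ A) (N : ℕ) :
    ∃ f : K, (b - algebraMap K L f) / algebraMap K L π ^ N ∈ A := by
  have hπ' : algebraMap K L π ≠ 0 := by simpa using hπ0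
  induction N with
  | zero => exact ⟨0, by simpa using hb⟩
  | succ N ih =>
    obtain ⟨f, hf⟩ := ih
    obtain ⟨g, hg⟩ := hres _ hf
    refine ⟨f + π ^ N * g, ?_⟩
    convert hg using 1
    simp only [map_add, map_mul, map_pow]
    field_simp
    ring

/-- If every element of `A` is approximated by elements of `K` to arbitrary `π`-adic precision, then
every extension `B` of the place `A ∩ K` to `L` has trivial decomposition group. -/
theorem ValuationSubring.decompositionSubgroup_eq_bot_of_approx [IsGalois K L]
    [FiniteDimensional K L] (A : ValuationSubring L) (π : K)
    (hπ : algebraMap K L π ∈ A) (hπ' : (algebraMap K L π)⁻¹ ∉ A)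
    (hres : ∀ b ∈ A, ∃ f : K, (b - algebraMap K L f) / algebraMap K L π ∈ A)
    (harch : ∀ x : L, ∃ k : ℕ, algebraMap K L π ^ k * x ∈ A)
    (B : ValuationSubring L) (hB : B.comap (algebraMap K L) = A.comap (algebraMap K L)) :
    B.decompositionSubgroup K = ⊥ := by
  have hcomap : ∀ k : K, algebraMap K L k ∈ B ↔ algebraMap K L k ∈ A := fun k => by
    have := SetLike.ext_iff.1 hB k
    simpa [ValuationSubring.mem_comap] using this
  have hp0 : algebraMap K L π ≠ 0 := fun h => hπ' (by rw [h, inv_zero]; exact A.zero_mem)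
  have hπ0 : π ≠ 0 := fun h => hp0 (by rw [h, map_zero])
  have hπB : algebraMap K L π ∈ B := (hcomap _).2 hπ
  have hπB' : (algebraMap K L π)⁻¹ ∉ B := fun h =>
    hπ' (by rw [← map_inv₀] at h ⊢; exact (hcomap _).1 h)
  have hval : B.valuation (algebraMap K L π) < 1 := by
    rw [← ValuationSubring.mem_nonunits_iff, ValuationSubring.mem_nonunits_iff_or]
    exact Or.inr hπB'
  have hconj : ∀ x : L, ∃ k : ℕ, ∀ σ : L ≃ₐ[K] L, σ (algebraMap K L π ^ k * x) ∈ A := by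
    intro x
    choose k hk using fun σ : L ≃ₐ[K] L => harch (σ x)
    refine ⟨∑ σ, k σ, fun σ => ?_⟩
    have hle : k σ ≤ ∑ σ, k σ := Finset.single_le_sum (fun _ _ => Nat.zero_le _) (Finset.mem_univ σ)
    obtain ⟨m, hm⟩ := Nat.exists_eq_add_of_le' hle
    rw [map_mul, map_pow, AlgEquiv.commutes, hm, pow_add, mul_assoc]
    exact A.mul_mem _ _ (pow_mem hπ m) (hk σ)
  rw [eq_bot_iff]
  intro τ hτ
  rw [Subgroup.mem_bot]
  by_contra hne
  obtain ⟨x₀, hx₀⟩ : ∃ x, τ x ≠ x := by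
    by_contra! h
    exact hne (AlgEquiv.ext h)
  obtain ⟨k, hk⟩ := hconj x₀
  obtain ⟨x, hx⟩ : ∃ x : L, x = algebraMap K L π ^ k * x₀ := ⟨_, rfl⟩
  rw [← hx] at hk
  have hxB : x ∈ B := mem_of_forall_conj_mem hB.ge x hk
  have hτx : τ x - x ≠ 0 := by
    rw [hx, map_mul, map_pow, AlgEquiv.commutes, ← mul_sub]
    exact mul_ne_zero (pow_ne_zero _ hp0) (sub_ne_zero.2 hx₀)
  have key : ∀ N : ℕ, (τ x - x) / algebraMap K L π ^ N ∈ B := by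
    intro N
    set M := N * Fintype.card (L ≃ₐ[K] L) + 1 with hM
    choose f hf using fun σ : L ≃ₐ[K] L => A.exists_sub_div_pow_mem π hπ0 hres (σ x) (hk σ) M
    have hfA : ∀ σ, algebraMap K L (f σ) ∈ A := fun σ => by
      have := sub_mem (hk σ) (A.mul_mem _ _ (pow_mem hπ M) (hf σ))
      rwa [mul_div_cancel₀ _ (pow_ne_zero _ hp0), sub_sub_cancel] at this
    obtain ⟨q, hqA, hq'⟩ := A.exists_prod_X_sub_C_eq_add Finset.univ
      (fun σ : L ≃ₐ[K] L => algebraMap K L (f σ)) (fun σ => σ x)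
      (algebraMap K L π ^ M) (pow_mem hπ M) hfA hk (fun σ => ⟨_, hf σ, by
        rw [mul_div_cancel₀ _ (pow_ne_zero M hp0)]⟩)
    have hqB : ∀ n, q.coeff n ∈ B := by
      intro n
      obtain ⟨c, hc⟩ := coeff_prod_X_sub_C_mem_range (K := K) x n
      have h1 := congrArg (fun p => p.coeff n) hq'
      have h2 : ∏ σ : L ≃ₐ[K] L, (X - C (algebraMap K L (f σ))) =
          (∏ σ : L ≃ₐ[K] L, (X - C (f σ))).map (algebraMap K L) := by
        simp [Polynomial.map_prod]
      simp only [coeff_add, coeff_C_mul] at h1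
      rw [h2, coeff_map, ← hc] at h1
      have h3 : q.coeff n =
          algebraMap K L (((∏ σ : L ≃ₐ[K] L, (X - C (f σ))).coeff n - c) / π ^ M) := by
        rw [map_div₀, map_sub, h1, map_pow, add_sub_cancel_left,
          mul_div_cancel_left₀ _ (pow_ne_zero _ hp0)]
      rw [h3, hcomap, ← h3]
      exact hqA n
    have hev := congrArg (eval x) hq'
    rw [eval_add, eval_prod, eval_prod, eval_mul, Finset.prod_eq_zero (i := 1)
      (f := fun σ : L ≃ₐ[K] L => eval x (X - C (σ x))) (Finset.mem_univ _) (by simp), zero_add,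
      eval_C] at hev
    simp only [eval_sub, eval_X, eval_C] at hev
    have hqx : q.eval x ∈ B := by
      rw [eval_eq_sum_range]
      exact sum_mem fun i _ => B.mul_mem _ _ (hqB i) (pow_mem hxB i)
    obtain ⟨σ, -, hσ⟩ := B.exists_mem_of_valuation_prod_lt_one Finset.univ
      (fun σ => (x - algebraMap K L (f σ)) / algebraMap K L π ^ N) (by
        rw [Finset.prod_div_distrib, hev, Finset.prod_const, Finset.card_univ, ← pow_mul, hM,
          pow_succ, mul_assoc, mul_div_cancel_left₀ _ (pow_ne_zero _ hp0), map_mul]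
        exact mul_lt_one_of_lt_of_le hval ((B.valuation_le_one_iff _).2 hqx))
    have hτσ : τ ((x - algebraMap K L (f σ)) / algebraMap K L π ^ N) ∈ B := by
      have : τ • B = B := hτ
      have h4 := ValuationSubring.smul_mem_pointwise_smul τ _ B hσ
      rwa [this] at h4
    have := sub_mem hτσ hσ
    rw [map_div₀, map_sub, map_pow, AlgEquiv.commutes, AlgEquiv.commutes, ← sub_div] at this
    simpa using this
  obtain ⟨m, hm⟩ := hconj (τ x - x)⁻¹
  have h5 := B.mul_mem _ _ (key (m + 1)) (mem_of_forall_conj_mem hB.ge _ hm)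
  refine hπB' ?_
  convert h5 using 1
  field_simp
  rw [pow_succ']
end

section
variable {F E K L : Type*} [Field F] [CharZero F] [Field E] [Algebra F E] [FiniteDimensional F E]
  [Field K] [Field L] [Algebra K L]

theorem shiftHom_minpoly (x : E) : ∃ w : PowerSeries E, IsUnit w ∧
    shiftHom F x (minpoly F x) = PowerSeries.X * w := by
  have hx : IsIntegral F x := IsIntegral.of_finite _ _
  obtain ⟨w, hw⟩ := PowerSeries.X_dvd_iff.2
    (show PowerSeries.constantCoeff (shiftHom F x (minpoly F x)) = 0 by
      rw [constantCoeff_shiftHom, minpoly.aeval])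
  refine ⟨w, ?_, hw⟩
  have h1 := coeff_one_shiftHom x (minpoly F x)
  rw [hw, ← zero_add 1, PowerSeries.coeff_succ_X_mul,
    PowerSeries.coeff_zero_eq_constantCoeff_apply] at h1
  rw [PowerSeries.isUnit_iff_constantCoeff, h1, isUnit_iff_ne_zero]
  exact (minpoly.irreducible hx).separable.aeval_derivative_ne_zero (minpoly.aeval F x)

/-- If the completion of `F(X)` at a closed point receives an `F(X)`-embedding of `L`, then the
induced place of `K` is totally split in `L`. -/
theorem exists_totally_split [Algebra (RatFunc F) K] [Algebra (RatFunc F) L]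
    [IsScalarTower (RatFunc F) K L] [IsGalois K L] [FiniteDimensional K L] (x : E)
    (hx : Algebra.adjoin F {x} = ⊤) (φ : L →+* LaurentSeries E)
    (hφ : ∀ f, φ (algebraMap (RatFunc F) L (algebraMap F[X] (RatFunc F) f)) =
      HahnSeries.ofPowerSeries ℤ E (shiftHom F x f)) :
    ∃ v : ValuationSubring K, v ≠ ⊤ ∧
      (∀ f : F[X], algebraMap (RatFunc F) K (algebraMap F[X] (RatFunc F) f) ∈ v) ∧
      ∀ B : ValuationSubring L, B.comap (algebraMap K L) = v →
        B.decompositionSubgroup K = ⊥ := by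
  let i : F[X] →+* K := (algebraMap (RatFunc F) K).comp (algebraMap F[X] (RatFunc F))
  replace hφ : ∀ f, φ (algebraMap K L (i f)) = HahnSeries.ofPowerSeries ℤ E (shiftHom F x f) :=
    fun f => by rw [← hφ f, IsScalarTower.algebraMap_apply (RatFunc F) K L]; rfl
  let A : ValuationSubring L := (Valued.v : Valuation (LaurentSeries E)
    (WithZero (Multiplicative ℤ))).valuationSubring.comap φ
  have hA : ∀ b, b ∈ A ↔ ∃ g : PowerSeries E, HahnSeries.ofPowerSeries ℤ E g = φ b := fun b =>
    LaurentSeries.val_le_one_iff_eq_coe E (φ b)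
  obtain ⟨w, hw, hpw⟩ := shiftHom_minpoly (F := F) x
  obtain ⟨w', hww'⟩ := hw.exists_right_inv
  have hπ := hφ (minpoly F x)
  rw [hpw, map_mul] at hπ
  have hX0 : HahnSeries.ofPowerSeries ℤ E PowerSeries.X ≠ 0 := by simp
  have hww : HahnSeries.ofPowerSeries ℤ E w * HahnSeries.ofPowerSeries ℤ E w' = 1 := by
    rw [← map_mul, hww', map_one]
  have hw0 : HahnSeries.ofPowerSeries ℤ E w ≠ 0 := left_ne_zero_of_mul_eq_one hww
  have hπinv : (algebraMap K L (i (minpoly F x)))⁻¹ ∉ A := by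
    rw [hA]
    rintro ⟨g, hg⟩
    rw [map_inv₀, hπ, ← mul_eq_one_iff_eq_inv₀ (mul_ne_zero hX0 hw0), ← map_mul, ← map_mul,
      ← map_one (HahnSeries.ofPowerSeries ℤ E)] at hg
    have := congrArg PowerSeries.constantCoeff (HahnSeries.ofPowerSeries_injective hg)
    simp at this
  refine ⟨A.comap (algebraMap K L), ?_, fun f => (hA _).2 ⟨_, (hφ f).symm⟩, fun B hB =>
    A.decompositionSubgroup_eq_bot_of_approx (i (minpoly F x)) ((hA _).2 ⟨_, (hφ _).symm⟩)
      hπinv ?_ ?_ B hB⟩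
  · intro h
    apply hπinv
    rw [← map_inv₀, ← ValuationSubring.mem_comap, h]
    exact ValuationSubring.mem_top _
  · intro b hb
    obtain ⟨g, hg⟩ := (hA b).1 hb
    obtain ⟨f, hf⟩ : ∃ f : F[X], aeval x f = PowerSeries.constantCoeff g := by
      have : PowerSeries.constantCoeff g ∈ Algebra.adjoin F {x} := hx ▸ Algebra.mem_top
      rwa [Algebra.adjoin_singleton_eq_range_aeval] at this
    obtain ⟨q, hq⟩ := PowerSeries.X_dvd_iff.2
      (show PowerSeries.constantCoeff (g - shiftHom F x f) = 0 by
        rw [map_sub, constantCoeff_shiftHom, hf, sub_self])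
    refine ⟨i f, (hA _).2 ⟨q * w', ?_⟩⟩
    rw [map_div₀, map_sub, ← hg, hφ, hπ, ← map_sub, hq, map_mul, map_mul,
      eq_div_iff (mul_ne_zero hX0 hw0)]
    linear_combination (HahnSeries.ofPowerSeries ℤ E q *
      HahnSeries.ofPowerSeries ℤ E PowerSeries.X) * hww
  · intro b
    obtain ⟨⟨g, _, n, rfl⟩, hg⟩ :=
      IsLocalization.surj (Submonoid.powers (PowerSeries.X : PowerSeries E)) (φ b)
    refine ⟨n, (hA _).2 ⟨w ^ n * g, ?_⟩⟩
    simp only [LaurentSeries.coe_algebraMap, map_pow] at hg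
    rw [map_mul, map_mul, map_pow, map_pow, hπ, ← hg]
    ring
end

/-- Let `K` be the function field of a smooth projective curve over `ℂ((t))`
(equivalently, a finite extension of the rational function field `ℂ((t))(u)`) and let
`L/K` be a finite Galois extension. Then there exists a place `v` of `K` (a valuation
subring `≠ K` containing the image of `ℂ((t))`) that is totally split in `L/K`, i.e. such
that the decomposition group of every extension of `v` to `L` is trivial. -/
theorem stmt_2 (K L : Type) [Field K] [Field L]
    [Algebra (LaurentSeries ℂ) K]
    [Algebra (RatFunc (LaurentSeries ℂ)) K]
    [IsScalarTower (LaurentSeries ℂ) (RatFunc (LaurentSeries ℂ)) K]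
    [FiniteDimensional (RatFunc (LaurentSeries ℂ)) K]
    [Algebra K L] [IsGalois K L] [FiniteDimensional K L] :
    ∃ v : ValuationSubring K, v ≠ ⊤ ∧
      (∀ a : LaurentSeries ℂ, algebraMap (LaurentSeries ℂ) K a ∈ v) ∧
      ∀ B : ValuationSubring L, B.comap (algebraMap K L) = v →
        B.decompositionSubgroup K = ⊥ := by
  have : CharZero (LaurentSeries ℂ) :=
    charZero_of_injective_algebraMap (algebraMap ℂ (LaurentSeries ℂ)).injective
  let : Algebra (RatFunc (LaurentSeries ℂ)) L :=
    ((algebraMap K L).comp (algebraMap (RatFunc (LaurentSeries ℂ)) K)).toAlgebra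
  have : IsScalarTower (RatFunc (LaurentSeries ℂ)) K L :=
    IsScalarTower.of_algebraMap_eq fun _ => rfl
  have : FiniteDimensional (RatFunc (LaurentSeries ℂ)) L :=
    FiniteDimensional.trans (RatFunc (LaurentSeries ℂ)) K L
  obtain ⟨θ, P, hθ, hP, hmin⟩ := exists_monic_generator (LaurentSeries ℂ) L
  have hint : IsIntegral (RatFunc (LaurentSeries ℂ)) θ := IsIntegral.of_finite _ _
  obtain ⟨d, a, b, hd, hab⟩ :=
    exists_bezout_of_separable (K := RatFunc (LaurentSeries ℂ)) P (by
      rw [← hmin]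
      exact (minpoly.irreducible hint).separable)
  have hev : ∀ {E : Type} [Field E] [Algebra (LaurentSeries ℂ) E] (x y : E),
      P.eval₂ (aeval x).toRingHom y = 0 → aeval x d ≠ 0 →
      P.derivative.eval₂ (aeval x).toRingHom y ≠ 0 := by
    intro E _ _ x y h0 hd h1
    have h2 := congrArg (eval₂ (aeval x).toRingHom y) hab
    rw [eval₂_add, eval₂_mul, eval₂_mul, h0, h1, mul_zero, mul_zero, add_zero, eval₂_C] at h2
    exact hd h2.symm
  obtain ⟨u, hu⟩ : ∃ u, d.eval u ≠ 0 := by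
    by_contra! h
    exact hd (Polynomial.funext fun r => by rw [h, eval_zero])
  let Q := P.map (evalRingHom u)
  have hQ : Q.degree ≠ 0 := by
    rw [hP.degree_map, ← hP.degree_map (algebraMap _ (RatFunc (LaurentSeries ℂ))), ← hmin]
    exact (minpoly.degree_pos hint).ne'
  obtain ⟨y₀, hy₀⟩ := (SplittingField.splits Q).exists_eval_eq_zero (by rwa [degree_map])
  have hQ0 : P.eval₂ (aeval (algebraMap (LaurentSeries ℂ) Q.SplittingField u)).toRingHom y₀ = 0 := by
    rw [← hy₀, eval_map, eval₂_map]
    congr 1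
    ext <;> simp
  have hdu : aeval (algebraMap (LaurentSeries ℂ) Q.SplittingField u) d ≠ 0 := by
    rw [aeval_algebraMap_apply]
    simpa using hu
  obtain ⟨x, y, hxy, hdx, hx⟩ :=
    LaurentSeries.exists_root_generating P d u y₀ hu hQ0 (hev _ _ hQ0 hdu)
  obtain ⟨Θ, hΘ⟩ := exists_eval₂_shiftHom_eq_zero x P hP y hxy (hev x y hxy hdx)
  obtain ⟨φ, hφ⟩ := exists_ringHom_laurentSeries x θ hθ P hmin Θ hΘ
  obtain ⟨v, hv, hvi, hB⟩ := exists_totally_split (K := K) x hx φ hφ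
  refine ⟨v, hv, fun c => ?_, hB⟩
  have hc := hvi (C c)
  rw [IsScalarTower.algebraMap_apply (LaurentSeries ℂ) (RatFunc (LaurentSeries ℂ)) K]
  exact hc
end
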